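/- arXiv:2410.13617 — 2 statements merged into one kernel-verified Lean document; each statement's English description precedes it below -/
import Mathlib

section
/- The graded ring R(P) := ℝ[x_1, …, x_r, y_1, …, y_r]/(I + J) has total dimension 2^r as an ℝ-vector space; more precisely, its Poincaré polynomial is (1+q)^r, i.e. for each 0 ≤ k ≤ r the degree-2k homogeneous component of R(P) has ℝ-dimension equal to the binomial coefficient C(r,k). -/
open scoped RealInnerProductSpace BigOperators
open MvPolynomial

noncomputable section

/-- A finite reflection group on a Euclidean space `E` of dimension `r`, with simple system
`alpha 1, …, alpha r`. -/
structure CoxSetup (r : ℕ) (E : Type*) [NormedAddCommGroup E] [InnerProductSpace ℝ E] :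
    Type _ where
  hr : 1 ≤ r
  fd : FiniteDimensional ℝ E
  hdim : Module.finrank ℝ E = r
  alpha : Fin r → E
  indep : LinearIndependent ℝ alpha
  unit : ∀ i, ‖alpha i‖ = 1
  s : Fin r → (E ≃ₗᵢ[ℝ] E)
  hs : ∀ i x, s i x = x - (2 * ⟪x, alpha i⟫) • alpha i
  fin : (Subgroup.closure (Set.range s) : Set (E ≃ₗᵢ[ℝ] E)).Finite
  roots : ∀ g ∈ Subgroup.closure (Set.range s), ∀ i,
      (∃ c : Fin r → ℝ, (∀ k, 0 ≤ c k) ∧ g (alpha i) = ∑ k, c k • alpha k) ∨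
      (∃ c : Fin r → ℝ, (∀ k, c k ≤ 0) ∧ g (alpha i) = ∑ k, c k • alpha k)

namespace CoxSetup

variable {r : ℕ} {E : Type*} [NormedAddCommGroup E] [InnerProductSpace ℝ E]
variable (S : CoxSetup r E)

/-- The ideal `I = (x_i y_i : i ∈ [r])` of `ℝ[x_1,…,x_r,y_1,…,y_r]`, where the variables
`x_i` correspond to `Sum.inl i` and the variables `y_i` to `Sum.inr i`. -/
def IP (r : ℕ) : Ideal (MvPolynomial (Fin r ⊕ Fin r) ℝ) :=
  Ideal.span {m | ∃ i : Fin r, m = X (Sum.inl i) * X (Sum.inr i)}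

/-- The ideal `J = (x_j − ∑_i (α_j, α_i) y_i : j ∈ [r])` of `ℝ[x_1,…,x_r,y_1,…,y_r]`. -/
def JP : Ideal (MvPolynomial (Fin r ⊕ Fin r) ℝ) :=
  Ideal.span {f | ∃ j : Fin r,
    f = X (Sum.inl j) - ∑ i, (⟪S.alpha j, S.alpha i⟫ : ℝ) • X (Sum.inr i)}

end CoxSetup

open CoxSetup

namespace CoxSetup

section aux
variable {r : ℕ} {E : Type*} [NormedAddCommGroup E] [InnerProductSpace ℝ E]
variable (S : CoxSetup r E)

/-- span of the simple roots in `T` -/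
def KK (T : Finset (Fin r)) : Submodule ℝ E := Submodule.span ℝ (S.alpha '' (T : Set (Fin r)))

theorem exists_beta (T : Finset (Fin r)) (k : Fin r) :
    ∃ b : E, b ∈ (S.KK T)ᗮ ∧ S.alpha k - b ∈ S.KK T := by
  have := S.fd
  refine ⟨S.alpha k - (S.KK T).starProjection (S.alpha k), ?_, ?_⟩
  · exact Submodule.sub_starProjection_mem_orthogonal _
  · rw [sub_sub_cancel]
    exact Submodule.starProjection_apply_mem _ _

/-- projection of `alpha k` to the orthogonal complement of `KK T` -/
def beta (T : Finset (Fin r)) (k : Fin r) : E := (S.exists_beta T k).choose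

theorem beta_mem (T : Finset (Fin r)) (k : Fin r) : S.beta T k ∈ (S.KK T)ᗮ :=
  (S.exists_beta T k).choose_spec.1

theorem sub_beta_mem (T : Finset (Fin r)) (k : Fin r) : S.alpha k - S.beta T k ∈ S.KK T :=
  (S.exists_beta T k).choose_spec.2

theorem beta_unique (T : Finset (Fin r)) (k : Fin r) (b : E) (h1 : b ∈ (S.KK T)ᗮ)
    (h2 : S.alpha k - b ∈ S.KK T) : S.beta T k = b := by
  have h3 : S.beta T k - b ∈ (S.KK T)ᗮ := Submodule.sub_mem _ (S.beta_mem T k) h1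
  have h4 : S.beta T k - b ∈ S.KK T := by
    have := Submodule.sub_mem _ h2 (S.sub_beta_mem T k)
    simpa using this
  have := (Submodule.mem_orthogonal _ _).1 h3 _ h4
  exact sub_eq_zero.1 (inner_self_eq_zero.1 this)

theorem alpha_mem {T : Finset (Fin r)} {i : Fin r} (h : i ∈ T) : S.alpha i ∈ S.KK T :=
  Submodule.subset_span ⟨i, h, rfl⟩

theorem KK_mono {T T' : Finset (Fin r)} (h : T ⊆ T') : S.KK T ≤ S.KK T' :=
  Submodule.span_mono (Set.image_mono (by exact_mod_cast h))

theorem inner_alpha_beta {T : Finset (Fin r)} {i : Fin r} (h : i ∈ T) (k : Fin r) :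
    ⟪S.alpha i, S.beta T k⟫ = 0 :=
  (Submodule.mem_orthogonal _ _).1 (S.beta_mem T k) _ (S.alpha_mem h)

theorem beta_eq_zero {T : Finset (Fin r)} {i : Fin r} (h : i ∈ T) : S.beta T i = 0 :=
  S.beta_unique T i 0 (Submodule.zero_mem _) (by simpa using S.alpha_mem h)

theorem inner_alpha_beta' (T : Finset (Fin r)) (k l : Fin r) :
    ⟪S.alpha k, S.beta T l⟫ = ⟪S.beta T k, S.beta T l⟫ := by
  have := (Submodule.mem_orthogonal _ _).1 (S.beta_mem T l) _ (S.sub_beta_mem T k)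
  rw [inner_sub_left] at this
  linarith

theorem beta_insert (T : Finset (Fin r)) (k l : Fin r) :
    S.beta (insert k T) l = S.beta T l -
      (⟪S.beta T k, S.beta T l⟫ / ⟪S.beta T k, S.beta T k⟫) • S.beta T k := by
  apply S.beta_unique
  · have : ∀ i ∈ insert k T, ⟪S.alpha i, S.beta T l -
      (⟪S.beta T k, S.beta T l⟫ / ⟪S.beta T k, S.beta T k⟫) • S.beta T k⟫ = 0 := by
      intro i hi
      rw [inner_sub_right, inner_smul_right]
      rcases Finset.mem_insert.1 hi with rfl | hi
      · rw [inner_alpha_beta', inner_alpha_beta']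
        by_cases h : S.beta T i = 0
        · simp [h]
        · have : ⟪S.beta T i, S.beta T i⟫ ≠ 0 := by simpa using h
          field_simp
          simp
      · simp [S.inner_alpha_beta hi]
    rw [Submodule.mem_orthogonal]
    intro u hu
    induction hu using Submodule.span_induction with
    | mem x hx => obtain ⟨i, hi, rfl⟩ := hx; exact this i hi
    | zero => simp
    | add x y _ _ hx hy => rw [inner_add_left, hx, hy, add_zero]
    | smul a x _ hx => rw [inner_smul_left, hx, mul_zero]
  · have h1 := S.KK_mono (Finset.subset_insert k T) (S.sub_beta_mem T l)
    have h2 := S.KK_mono (Finset.subset_insert k T) (S.sub_beta_mem T k)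
    have h3 : S.beta T k ∈ S.KK (insert k T) := by
      have := Submodule.sub_mem _ (S.alpha_mem (Finset.mem_insert_self k T)) h2
      simpa using this
    rw [← sub_add]
    exact Submodule.add_mem _ h1 (Submodule.smul_mem _ _ h3)

theorem exists_omega : ∃ w : Fin r → E, ∀ i j, ⟪w i, S.alpha j⟫ = if i = j then 1 else 0 := by
  have := S.fd
  have : Nonempty (Fin r) := ⟨⟨0, S.hr⟩⟩
  let b := basisOfLinearIndependentOfCardEqFinrank S.indep (by simp [S.hdim])
  refine ⟨fun i => (InnerProductSpace.toDual ℝ E).symm (LinearMap.toContinuousLinearMap (b.coord i)),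
    fun i j => ?_⟩
  rw [InnerProductSpace.toDual_symm_apply]
  have : S.alpha j = b j := by simp [b]
  rw [this]
  simp [Finsupp.single_apply, eq_comm]

/-- fundamental coweights -/
def omega : Fin r → E := S.exists_omega.choose

theorem inner_omega (i j : Fin r) : ⟪S.omega i, S.alpha j⟫ = if i = j then 1 else 0 :=
  S.exists_omega.choose_spec i j

theorem span_alpha : Submodule.span ℝ (Set.range S.alpha) = ⊤ := by
  have := S.fd
  have : Nonempty (Fin r) := ⟨⟨0, S.hr⟩⟩
  have := (basisOfLinearIndependentOfCardEqFinrank S.indep (by simp [S.hdim])).span_eq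
  simpa using this

theorem ext_alpha {x y : E} (h : ∀ j, ⟪x, S.alpha j⟫ = ⟪y, S.alpha j⟫) : x = y := by
  apply ext_inner_right ℝ
  intro v
  have hv : v ∈ Submodule.span ℝ (Set.range S.alpha) := by rw [span_alpha]; trivial
  induction hv using Submodule.span_induction with
  | mem x hx => obtain ⟨i, rfl⟩ := hx; exact h i
  | zero => simp
  | add x y _ _ hx hy => rw [inner_add_right, hx, hy, inner_add_right]
  | smul a x _ hx => rw [inner_smul_right, hx, inner_smul_right]

theorem expand (u : E) : u = ∑ i, ⟪u, S.alpha i⟫ • S.omega i := by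
  apply S.ext_alpha
  intro j
  simp [sum_inner, inner_smul_left, inner_omega]

theorem inner_omega_beta {T : Finset (Fin r)} {i : Fin r} (hi : i ∉ T) (k : Fin r) :
    ⟪S.omega i, S.beta T k⟫ = if i = k then 1 else 0 := by
  have h : ∀ v ∈ S.KK T, ⟪S.omega i, v⟫ = 0 := by
    intro v hv
    induction hv using Submodule.span_induction with
    | mem x hx =>
      obtain ⟨j, hj, rfl⟩ := hx
      rw [inner_omega, if_neg]
      rintro rfl
      exact hi hj
    | zero => simp
    | add x y _ _ hx hy => rw [inner_add_right, hx, hy, add_zero]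
    | smul a x _ hx => rw [inner_smul_right, hx, mul_zero]
  have := h _ (S.sub_beta_mem T k)
  rw [inner_sub_right, inner_omega] at this
  linarith

theorem span_mixed (T : Finset (Fin r)) :
    Submodule.span ℝ (S.omega '' {i | i ∉ T}) ⊔ S.KK T = ⊤ := by
  have := S.fd
  rw [← Submodule.orthogonal_eq_bot_iff, Submodule.eq_bot_iff]
  intro w hw
  have h1 : ∀ i ∉ T, ⟪S.omega i, w⟫ = 0 := fun i hi =>
    (Submodule.mem_orthogonal _ _).1 hw _
      (Submodule.mem_sup_left (Submodule.subset_span ⟨i, hi, rfl⟩))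
  have h2 : ∀ i ∈ T, ⟪S.alpha i, w⟫ = 0 := fun i hi =>
    (Submodule.mem_orthogonal _ _).1 hw _ (Submodule.mem_sup_right (S.alpha_mem hi))
  have : ⟪w, w⟫ = 0 := by
    have he : ⟪w, w⟫ = ⟪∑ i, ⟪w, S.alpha i⟫ • S.omega i, w⟫ := by rw [← S.expand w]
    rw [he, sum_inner]
    apply Finset.sum_eq_zero
    intro i _
    rw [inner_smul_left]
    by_cases hi : i ∈ T
    · rw [real_inner_comm, h2 i hi]; simp
    · rw [h1 i hi]; simp
  exact inner_self_eq_zero.1 this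

/-- The model module. -/
abbrev VV (r : ℕ) := Finset (Fin r) →₀ ℝ

/-- the action of `u : E` on the model -/
def YY (u : E) : Module.End ℝ (VV r) :=
  Finsupp.linearCombination ℝ
    (fun T : Finset (Fin r) => ∑ k, ⟪u, S.beta T k⟫ • (Finsupp.single (insert k T) (1 : ℝ) : VV r))

theorem YY_single (u : E) (T : Finset (Fin r)) :
    S.YY u (Finsupp.single T 1) =
      ∑ k, ⟪u, S.beta T k⟫ • (Finsupp.single (insert k T) (1 : ℝ) : VV r) := by
  simp only [YY, Finsupp.linearCombination_single, one_smul]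

theorem End_ext {f g : Module.End ℝ (VV r)}
    (h : ∀ T, f (Finsupp.single T 1) = g (Finsupp.single T 1)) : f = g := by
  apply Finsupp.lhom_ext'
  intro T
  apply LinearMap.ext_ring
  exact h T

theorem YY_sub_sum (v : E) (c : Fin r → ℝ) (w : Fin r → E) (h : v = ∑ i, c i • w i) :
    S.YY v = ∑ i, c i • S.YY (w i) := by
  apply End_ext
  intro T
  subst h
  simp only [LinearMap.sum_apply, LinearMap.smul_apply, YY_single, sum_inner, inner_smul_left,
    Finset.smul_sum, Finset.sum_smul, smul_smul]
  rw [Finset.sum_comm]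
  rfl

theorem YY_comm (u v : E) : S.YY u * S.YY v = S.YY v * S.YY u := by
  have key : ∀ (u v : E) T, (S.YY u * S.YY v) (Finsupp.single T 1) =
      (∑ k, ∑ l, (⟪v, S.beta T k⟫ * ⟪u, S.beta T l⟫) •
        (Finsupp.single (insert l (insert k T)) (1 : ℝ) : VV r)) -
      ∑ k, ∑ l, (⟪v, S.beta T k⟫ * ⟪u, S.beta T k⟫ *
        (⟪S.beta T k, S.beta T l⟫ / ⟪S.beta T k, S.beta T k⟫)) •
        (Finsupp.single (insert l (insert k T)) (1 : ℝ) : VV r) := by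
    intro u v T
    rw [Module.End.mul_apply, YY_single, map_sum, ← Finset.sum_sub_distrib]
    refine Finset.sum_congr rfl fun k _ => ?_
    rw [map_smul, YY_single, Finset.smul_sum, ← Finset.sum_sub_distrib]
    refine Finset.sum_congr rfl fun l _ => ?_
    rw [beta_insert, inner_sub_right, inner_smul_right, smul_smul, ← sub_smul]
    congr 1
    ring
  apply End_ext
  intro T
  rw [key, key]
  congr 1
  · rw [Finset.sum_comm]
    refine Finset.sum_congr rfl fun k _ => Finset.sum_congr rfl fun l _ => ?_
    rw [Finset.insert_comm, mul_comm]
  · refine Finset.sum_congr rfl fun k _ => Finset.sum_congr rfl fun l _ => ?_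
    rw [mul_comm ⟪v, _⟫]

theorem YY_omega {T : Finset (Fin r)} {i : Fin r} (hi : i ∉ T) :
    S.YY (S.omega i) (Finsupp.single T 1) = Finsupp.single (insert i T) 1 := by
  rw [YY_single]
  simp only [S.inner_omega_beta hi]
  simp

theorem YY_alpha {T : Finset (Fin r)} {i : Fin r} (hi : i ∈ T) :
    S.YY (S.alpha i) (Finsupp.single T 1) = 0 := by
  rw [YY_single]
  simp only [S.inner_alpha_beta hi]
  simp

theorem YY_rel (i : Fin r) : S.YY (S.alpha i) * S.YY (S.omega i) = 0 := by
  apply End_ext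
  intro T
  by_cases hi : i ∈ T
  · rw [YY_comm, Module.End.mul_apply, S.YY_alpha hi]; simp
  · rw [Module.End.mul_apply, S.YY_omega hi, S.YY_alpha (Finset.mem_insert_self i T)]; simp

/-- the quotient ring -/
abbrev RR := MvPolynomial (Fin r ⊕ Fin r) ℝ ⧸ (IP r + S.JP)

/-- squarefree monomials in the quotient -/
def mon (T : Finset (Fin r)) : S.RR := Ideal.Quotient.mkₐ ℝ (IP r + S.JP) (∏ i ∈ T, X (Sum.inr i))

open scoped IsMulCommutative in
theorem exists_aeval {σ B : Type*} [Ring B] [Algebra ℝ B] (y : σ → B)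
    (hy : ∀ i j, y i * y j = y j * y i) :
    ∃ g : MvPolynomial σ ℝ →ₐ[ℝ] B, ∀ i, g (X i) = y i := by
  have : IsMulCommutative (Algebra.adjoin ℝ (Set.range y)) :=
    Algebra.isMulCommutative_adjoin ℝ (by
      rintro _ ⟨u, rfl⟩ _ ⟨v, rfl⟩
      exact hy u v)
  refine ⟨(Algebra.adjoin ℝ (Set.range y)).val.comp
    (aeval (fun i => (⟨y i, Algebra.subset_adjoin ⟨i, rfl⟩⟩ : Algebra.adjoin ℝ (Set.range y)))),
    fun i => ?_⟩
  simp

theorem exists_map : ∃ f : S.RR →ₗ[ℝ] VV r, ∀ T, f (S.mon T) = Finsupp.single T 1 := by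
  obtain ⟨g, hgX⟩ := exists_aeval
    (fun i : Fin r ⊕ Fin r => S.YY (Sum.elim S.alpha S.omega i)) (fun i j => S.YY_comm _ _)
  have hg : ∀ a ∈ IP r + S.JP, g a = 0 := by
    have : IP r + S.JP ≤ RingHom.ker g := by
      apply sup_le
      · refine Ideal.span_le.2 ?_
        rintro _ ⟨i, rfl⟩
        simp only [SetLike.mem_coe, RingHom.mem_ker, map_mul, hgX, Sum.elim_inl, Sum.elim_inr]
        exact S.YY_rel i
      · refine Ideal.span_le.2 ?_
        rintro _ ⟨j, rfl⟩
        simp only [SetLike.mem_coe, RingHom.mem_ker, map_sub, map_sum, map_smul, hgX,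
          Sum.elim_inl, Sum.elim_inr]
        rw [sub_eq_zero]
        exact S.YY_sub_sum (S.alpha j) _ _ (S.expand (S.alpha j))
    intro a ha
    exact this ha
  refine ⟨(LinearMap.applyₗ (Finsupp.single ∅ 1)) ∘ₗ
    (Ideal.Quotient.liftₐ _ g hg).toLinearMap, fun T => ?_⟩
  change g (∏ i ∈ T, X (Sum.inr i)) (Finsupp.single ∅ 1) = _
  induction T using Finset.induction_on with
  | empty => rw [Finset.prod_empty, map_one]; rfl
  | insert a T ha ih =>
    rw [Finset.prod_insert ha, map_mul, hgX, Module.End.mul_apply, ih, Sum.elim_inr, S.YY_omega ha]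

theorem mon_indep : LinearIndependent ℝ S.mon := by
  obtain ⟨f, hf⟩ := S.exists_map
  apply LinearIndependent.of_comp f
  have : f ∘ S.mon = fun T => Finsupp.single T 1 := funext hf
  rw [this]
  exact (Finsupp.basisSingleOne (R := ℝ) (ι := Finset (Fin r))).linearIndependent

/-- the linear map `E → R` -/
def phi : E →ₗ[ℝ] S.RR where
  toFun u := ∑ i, ⟪u, S.alpha i⟫ • Ideal.Quotient.mkₐ ℝ (IP r + S.JP) (X (Sum.inr i))
  map_add' u v := by simp [inner_add_left, add_smul, Finset.sum_add_distrib]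
  map_smul' c u := by simp [inner_smul_left, mul_smul, Finset.smul_sum]

theorem phi_omega (i : Fin r) :
    S.phi (S.omega i) = Ideal.Quotient.mkₐ ℝ (IP r + S.JP) (X (Sum.inr i)) := by
  simp [phi, inner_omega]

theorem phi_alpha (i : Fin r) :
    S.phi (S.alpha i) = Ideal.Quotient.mkₐ ℝ (IP r + S.JP) (X (Sum.inl i)) := by
  have h : Ideal.Quotient.mkₐ ℝ (IP r + S.JP)
      (X (Sum.inl i) - ∑ j, (⟪S.alpha i, S.alpha j⟫ : ℝ) • X (Sum.inr j)) = 0 := by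
    rw [Ideal.Quotient.mkₐ_eq_mk]
    exact Ideal.Quotient.eq_zero_iff_mem.2 (Ideal.mem_sup_right (Ideal.subset_span ⟨i, rfl⟩))
  rw [map_sub, sub_eq_zero, map_sum] at h
  rw [h]
  simp only [map_smul]
  rfl

theorem phi_rel (i : Fin r) : S.phi (S.omega i) * S.phi (S.alpha i) = 0 := by
  rw [phi_omega, phi_alpha, ← map_mul, mul_comm, Ideal.Quotient.mkₐ_eq_mk]
  exact Ideal.Quotient.eq_zero_iff_mem.2 (Ideal.mem_sup_left (Ideal.subset_span ⟨i, rfl⟩))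

theorem mon_eq (T : Finset (Fin r)) : S.mon T = ∏ i ∈ T, S.phi (S.omega i) := by
  simp only [mon, map_prod, phi_omega]

/-- span of squarefree monomials of degree `k` -/
def LL (k : ℕ) : Submodule ℝ S.RR := Submodule.span ℝ (S.mon '' {T | T.card = k})

theorem mon_mul (T : Finset (Fin r)) (u : E) : S.mon T * S.phi u ∈ S.LL (T.card + 1) := by
  have hu : u ∈ Submodule.span ℝ (S.omega '' {i | i ∉ T}) ⊔ S.KK T := by
    rw [span_mixed]; trivial
  have : Submodule.span ℝ (S.omega '' {i | i ∉ T}) ⊔ S.KK T ≤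
      (S.LL (T.card + 1)).comap (LinearMap.mulLeft ℝ (S.mon T) ∘ₗ S.phi) := by
    apply sup_le
    · refine Submodule.span_le.2 ?_
      rintro _ ⟨i, hi, rfl⟩
      refine Submodule.subset_span ⟨insert i T, Finset.card_insert_of_notMem hi, ?_⟩
      rw [mon_eq, Finset.prod_insert hi, ← mon_eq, mul_comm]
      rfl
    · refine Submodule.span_le.2 ?_
      rintro _ ⟨i, hi, rfl⟩
      have : S.mon T * S.phi (S.alpha i) = 0 := by
        rw [mon_eq, ← Finset.mul_prod_erase T _ hi, mul_right_comm, phi_rel, zero_mul]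
      change S.mon T * S.phi (S.alpha i) ∈ S.LL (T.card + 1)
      rw [this]
      exact Submodule.zero_mem _
  exact this hu

theorem LL_mul {k : ℕ} {a : S.RR} (ha : a ∈ S.LL k) (u : E) : a * S.phi u ∈ S.LL (k + 1) := by
  have : S.LL k ≤ (S.LL (k + 1)).comap (LinearMap.mulRight ℝ (S.phi u)) := by
    refine Submodule.span_le.2 ?_
    rintro _ ⟨T, rfl, rfl⟩
    exact S.mon_mul T u
  exact this ha

theorem exists_phi (i : Fin r ⊕ Fin r) :
    ∃ u, Ideal.Quotient.mkₐ ℝ (IP r + S.JP) (X i) = S.phi u := by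
  rcases i with i | i
  · exact ⟨_, (S.phi_alpha i).symm⟩
  · exact ⟨_, (S.phi_omega i).symm⟩

theorem monomial_mem (d : (Fin r ⊕ Fin r) →₀ ℕ) :
    Ideal.Quotient.mkₐ ℝ (IP r + S.JP) (monomial d 1) ∈ S.LL d.degree := by
  obtain ⟨n, hn⟩ : ∃ n, n = d.degree := ⟨_, rfl⟩
  induction n generalizing d with
  | zero =>
    have hd : d = 0 := (Finsupp.degree_eq_zero_iff d).1 hn.symm
    subst hd
    refine Submodule.subset_span ⟨∅, ?_, ?_⟩
    · simp
    · simp [mon]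
  | succ n ih =>
    have hd : d ≠ 0 := by
      rintro rfl
      simp at hn
    obtain ⟨i, hi⟩ := Finsupp.ne_iff.1 hd
    have hle : Finsupp.single i 1 ≤ d := by
      rw [Finsupp.single_le_iff]
      exact Nat.one_le_iff_ne_zero.2 hi
    obtain ⟨e, rfl⟩ := exists_add_of_le hle
    rw [add_comm (Finsupp.single i 1) e] at hn ⊢
    have hdeg : (e + Finsupp.single i 1).degree = e.degree + 1 := by
      simp
    rw [hdeg] at hn ⊢
    obtain ⟨u, hu⟩ := S.exists_phi i
    rw [monomial_add_single, pow_one, map_mul, hu]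
    exact S.LL_mul (ih e (by omega)) u

theorem map_eq (k : ℕ) : Submodule.map (Ideal.Quotient.mkₐ ℝ (IP r + S.JP)).toLinearMap
        (MvPolynomial.homogeneousSubmodule (Fin r ⊕ Fin r) ℝ k) = S.LL k := by
  apply le_antisymm
  · rw [Submodule.map_le_iff_le_comap]
    intro p hp
    rw [mem_homogeneousSubmodule] at hp
    rw [p.as_sum]
    refine Submodule.sum_mem _ fun d hd => ?_
    have hk : d.degree = k := by
      have := hp (mem_support_iff.1 hd)
      rw [Finsupp.degree_eq_weight_one]
      exact this
    have : monomial d (coeff d p) = (coeff d p) • monomial d (1 : ℝ) := by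
      rw [smul_monomial]; simp
    rw [this]
    refine Submodule.smul_mem _ _ ?_
    rw [← hk]
    exact S.monomial_mem d
  · refine Submodule.span_le.2 ?_
    rintro _ ⟨T, rfl, rfl⟩
    refine ⟨∏ i ∈ T, X (Sum.inr i), ?_, rfl⟩
    rw [SetLike.mem_coe, mem_homogeneousSubmodule]
    have := IsHomogeneous.prod (R := ℝ) T (fun i => (X (Sum.inr i) : MvPolynomial (Fin r ⊕ Fin r) ℝ))
      (fun _ => 1) (fun i _ => isHomogeneous_X _ _)
    simpa using this

theorem span_mon : Submodule.span ℝ (Set.range S.mon) = ⊤ := by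
  rw [eq_top_iff]
  rintro a -
  obtain ⟨p, rfl⟩ := Ideal.Quotient.mkₐ_surjective ℝ (IP r + S.JP) a
  rw [p.as_sum, map_sum]
  refine Submodule.sum_mem _ fun d hd => ?_
  have : monomial d (coeff d p) = (coeff d p) • monomial d (1 : ℝ) := by
    rw [smul_monomial]; simp
  rw [this, map_smul]
  refine Submodule.smul_mem _ _ ?_
  exact Submodule.span_mono (Set.image_subset_range _ _) (S.monomial_mem d)

theorem finrank_LL (k : ℕ) : Module.finrank ℝ (S.LL k) = r.choose k := by
  have h := S.mon_indep.comp (fun T : {T : Finset (Fin r) // T.card = k} => T.1)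
    Subtype.val_injective
  have h2 := finrank_span_eq_card h
  have h3 : Set.range (S.mon ∘ (fun T : {T : Finset (Fin r) // T.card = k} => T.1)) =
      S.mon '' {T | T.card = k} := by
    rw [Set.range_comp, Subtype.range_coe_subtype]
  rw [h3] at h2
  rw [LL, h2]
  simp

end aux

end CoxSetup

/-- The graded ring `R(P) = ℝ[x_1,…,x_r,y_1,…,y_r]/(I + J)`, in which all
variables have degree `2`, has total dimension `2^r` as an `ℝ`-vector space, and its Poincaré
polynomial is `(1+q)^r`: for `0 ≤ k ≤ r` the degree-`2k` homogeneous component (the image of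
the space of polynomials that are homogeneous of ordinary degree `k`) has dimension `C(r,k)`. -/
theorem stmt14 {r : ℕ} {E : Type*} [NormedAddCommGroup E] [InnerProductSpace ℝ E]
    (S : CoxSetup r E) :
    Module.finrank ℝ (MvPolynomial (Fin r ⊕ Fin r) ℝ ⧸ (IP r + S.JP)) = 2 ^ r ∧
    ∀ k : ℕ, k ≤ r →
      Module.finrank ℝ (Submodule.map (Ideal.Quotient.mkₐ ℝ (IP r + S.JP)).toLinearMap
        (MvPolynomial.homogeneousSubmodule (Fin r ⊕ Fin r) ℝ k)) = r.choose k := by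
  refine ⟨?_, fun k _ => ?_⟩
  · have := finrank_span_eq_card S.mon_indep
    rw [span_mon, finrank_top] at this
    rw [this]
    simp
  · rw [map_eq, finrank_LL]
end
end

section
/- There is an isomorphism of graded ℚ-algebras A ≅ B^W, where A := ℚ[x_1, …, x_r, y_1, …, y_r]/(I + J) with I generated by {x_i y_i : i ∈ [r]} and J generated by the linear forms Σ_{i=1}^r ⟨q, ϖ_i^∨⟩ x_i − Σ_{i=1}^r ⟨q, β_i⟩ y_i for q ranging over the root lattice Λ_r, and where B := ℚ[X_{i,w} : i ∈ [r], w ∈ W^i]/(Ĩ + J̃) with Ĩ generated by the monomials X_{i_1,w_1}⋯X_{i_k,w_k} such that w_1 Q̃_{i_1} ∩ ⋯ ∩ w_k Q̃_{i_k} = ∅ and J̃ generated by the linear forms Σ_{i ∈ [r], w ∈ W^i} ⟨q, w ϖ_i^∨⟩ X_{i,w} for q ∈ Λ_r, and B^W is the subring of W-invariants for the W-action given by w′ · X_{i,w} := X_{i,u} with u ∈ W^i the minimal-length representative of w′wW_i. -/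
open scoped BigOperators
open MvPolynomial

noncomputable section

/-- A reduced crystallographic root system of rank `r` in an `r`-dimensional real vector
space `E`, presented by its simple roots `alpha i`, simple coroots `coalpha i` (vectors of the
dual space), fundamental coweights `copii i`, the associated simple reflections `s i`
generating a finite Weyl group, and a strongly dominant weight `lam`. -/
structure CrysSetup (r : ℕ) (E : Type*) [AddCommGroup E] [Module ℝ E] : Type _ where
  hr : 1 ≤ r
  fd : FiniteDimensional ℝ E
  hdim : Module.finrank ℝ E = r
  alpha : Fin r → E
  indep : LinearIndependent ℝ alpha
  coalpha : Fin r → Module.Dual ℝ E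
  pairing_self : ∀ i, coalpha i (alpha i) = 2
  crys : ∀ i j, ∃ n : ℤ, coalpha j (alpha i) = (n : ℝ)
  s : Fin r → (E ≃ₗ[ℝ] E)
  hs : ∀ i x, s i x = x - coalpha i x • alpha i
  fin : (Subgroup.closure (Set.range s) : Set (E ≃ₗ[ℝ] E)).Finite
  roots : ∀ g ∈ Subgroup.closure (Set.range s), ∀ i,
      (∃ c : Fin r → ℝ, (∀ k, 0 ≤ c k) ∧ g (alpha i) = ∑ k, c k • alpha k) ∨
      (∃ c : Fin r → ℝ, (∀ k, c k ≤ 0) ∧ g (alpha i) = ∑ k, c k • alpha k)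
  reduced : ∀ x ∈ {y : E | ∃ g ∈ Subgroup.closure (Set.range s), ∃ i, y = g (alpha i)},
      ∀ t : ℝ, t • x ∈ {y : E | ∃ g ∈ Subgroup.closure (Set.range s), ∃ i, y = g (alpha i)} →
      t = 1 ∨ t = -1
  copii : Fin r → Module.Dual ℝ E
  codual : ∀ i j, copii j (alpha i) = if i = j then 1 else 0
  lam : E
  dom : ∀ i, 0 < coalpha i lam

namespace CrysSetup

variable {r : ℕ} {E : Type*} [AddCommGroup E] [Module ℝ E]
variable (S : CrysSetup r E)

/-- The Weyl group `W`, as a group of linear automorphisms of `E`. -/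
def W : Subgroup (E ≃ₗ[ℝ] E) := Subgroup.closure (Set.range S.s)

/-- The root system `Φ` (the set of all roots, i.e. the `W`-orbit of the simple roots). -/
def Phi : Set E := {y | ∃ g ∈ S.W, ∃ i, y = g (S.alpha i)}

/-- The root lattice `Λ_r = ℤΦ`. -/
def rootLattice : Submodule ℤ E := Submodule.span ℤ S.Phi

/-- The coweight lattice `Λ_r^* = {v ∈ E^* : ⟨q, v⟩ ∈ ℤ for all q ∈ Λ_r}`. -/
def coweightLattice : Set (Module.Dual ℝ E) :=
  {v | ∀ q ∈ S.rootLattice, ∃ n : ℤ, v q = (n : ℝ)}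

/-- `β` is the family of primitive vectors of the coweight lattice lying on the rays
`ℝ_{>0} α_i^∨` spanned by the simple coroots. -/
def IsPrimitiveCoweightRay (beta : Fin r → Module.Dual ℝ E) : Prop :=
  ∀ i, beta i ∈ S.coweightLattice ∧ (∃ t : ℝ, 0 < t ∧ beta i = t • S.coalpha i) ∧
    ∀ v ∈ S.coweightLattice, (∃ t : ℝ, 0 < t ∧ v = t • S.coalpha i) →
      ∃ n : ℕ, v = (n : ℝ) • beta i

/-- The maximal parabolic subgroup `W_i = ⟨s_k : k ≠ i⟩`. -/
def Wpar (i : Fin r) : Subgroup (E ≃ₗ[ℝ] E) := Subgroup.closure (S.s '' {k | k ≠ i})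

/-- The coset space `W/W_i`, indexing the variables `X_{i,w}`, `w ∈ W^i`. -/
abbrev Coset (i : Fin r) := ↥S.W ⧸ (S.Wpar i).subgroupOf S.W

/-- The index set `{(i, w) : i ∈ [r], w ∈ W^i}` of the variables. -/
abbrev Idx := (i : Fin r) × S.Coset i

/-- The weight polytope `WP = conv(W·λ)`. -/
def WP : Set E := convexHull ℝ ((fun g : E ≃ₗ[ℝ] E => g S.lam) '' (S.W : Set (E ≃ₗ[ℝ] E)))

/-- The facet `Q̃_i` of `WP`. -/
def Qt (i : Fin r) : Set E :=
  {p | p ∈ S.WP ∧ ∃ a : Fin r → ℝ, (∀ k, 0 ≤ a k) ∧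
      p = S.lam - ∑ k ∈ Finset.univ.erase i, a k • S.alpha k}

/-- The translated facet `w Q̃_i` corresponding to an index. -/
def translate (p : S.Idx) : Set E :=
  ((Quotient.out p.2 : ↥S.W) : E ≃ₗ[ℝ] E) '' S.Qt p.1

/-- The Stanley–Reisner ideal `Ĩ` of `ℚ[X_{i,w}]`. -/
def Itil : Ideal (MvPolynomial S.Idx ℚ) :=
  Ideal.span {m | ∃ l : List S.Idx, l ≠ [] ∧ m = (l.map X).prod ∧
    ⋂ p ∈ l, S.translate p = ∅}

/-- The linear ideal `J̃` of `ℚ[X_{i,w}]`: it is generated by the linear forms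
`∑_{i,w} ⟨q, w ϖ_i^∨⟩ X_{i,w}` for `q` in the root lattice; here
`⟨q, w ϖ_i^∨⟩ = ϖ_i^∨(w⁻¹ q)` is an integer, recorded by the function `a`. -/
def Jtil : Ideal (MvPolynomial S.Idx ℚ) :=
  Ideal.span {f | ∃ q ∈ S.rootLattice, ∃ a : S.Idx → ℤ,
    (∀ p : S.Idx, S.copii p.1 (((Quotient.out p.2 : ↥S.W) : E ≃ₗ[ℝ] E).symm q) = (a p : ℝ)) ∧
    f = ∑ᶠ p : S.Idx, (a p : ℚ) • X p}

/-- The action of `w' ∈ W` on `ℚ[X_{i,w}]`, determined on variables by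
`w' ⬝ X_{i,w} = X_{i,u}` where `u` is the minimal-length representative of `w'wW_i`. -/
def act (g : ↥S.W) : MvPolynomial S.Idx ℚ ≃ₐ[ℚ] MvPolynomial S.Idx ℚ :=
  MvPolynomial.renameEquiv ℚ (Equiv.sigmaCongrRight fun _ => MulAction.toPerm g)

/-- The ideal `I = (x_i y_i : i ∈ [r])` of `ℚ[x_1,…,x_r,y_1,…,y_r]`. -/
def IQ (r : ℕ) : Ideal (MvPolynomial (Fin r ⊕ Fin r) ℚ) :=
  Ideal.span {m | ∃ i : Fin r, m = X (Sum.inl i) * X (Sum.inr i)}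

/-- The ideal `J` of `ℚ[x_1,…,x_r,y_1,…,y_r]` generated by the linear forms
`∑_i ⟨q, ϖ_i^∨⟩ x_i − ∑_i ⟨q, β_i⟩ y_i` for `q` in the root lattice; the integers
`⟨q, ϖ_i^∨⟩` and `⟨q, β_i⟩` are recorded by the functions `a` and `b`. -/
def JQ (beta : Fin r → Module.Dual ℝ E) : Ideal (MvPolynomial (Fin r ⊕ Fin r) ℚ) :=
  Ideal.span {f | ∃ q ∈ S.rootLattice, ∃ a b : Fin r → ℤ,
    (∀ i, S.copii i q = (a i : ℝ)) ∧ (∀ i, beta i q = (b i : ℝ)) ∧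
    f = ∑ i, (a i : ℚ) • X (Sum.inl i) - ∑ i, (b i : ℚ) • X (Sum.inr i)}

end CrysSetup


namespace CrysSetup

variable {r : ℕ} {E : Type*} [AddCommGroup E] [Module ℝ E]
variable (S : CrysSetup r E)

/-! ### Basic facts on the root system -/

lemma expand (q : E) : q = ∑ i, S.copii i q • S.alpha i := by
  have := S.fd
  have : Nonempty (Fin r) := ⟨⟨0, S.hr⟩⟩
  have hspan : Submodule.span ℝ (Set.range S.alpha) = ⊤ :=
    S.indep.span_eq_top_of_card_eq_finrank (by simp [S.hdim])
  have hq : q ∈ Submodule.span ℝ (Set.range S.alpha) := by rw [hspan]; trivial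
  obtain ⟨c, hc⟩ := (Submodule.mem_span_range_iff_exists_fun ℝ).1 hq
  have h : ∀ i, S.copii i q = c i := by
    intro i
    rw [← hc]
    simp [S.codual]
  simp [h, hc]

lemma ext_copii {x y : E} (h : ∀ i, S.copii i x = S.copii i y) : x = y := by
  rw [S.expand x, S.expand y]
  simp [h]

lemma alpha_ne (i : Fin r) : S.alpha i ≠ 0 := S.indep.ne_zero i

lemma copii_alpha (i j : Fin r) : S.copii j (S.alpha i) = if i = j then 1 else 0 := S.codual i j

lemma copii_s_ne {i k : Fin r} (h : k ≠ i) (x : E) : S.copii i (S.s k x) = S.copii i x := by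
  simp [S.hs, S.codual, h]

lemma s_mul_s (i : Fin r) : S.s i * S.s i = 1 := by
  ext x
  simp only [LinearEquiv.mul_apply, LinearEquiv.coe_one, id_eq]
  rw [S.hs i (S.s i x), S.hs i x]
  simp only [map_sub, map_smul, S.pairing_self, smul_eq_mul]
  module

lemma s_mem (i : Fin r) : S.s i ∈ S.W := Subgroup.subset_closure ⟨i, rfl⟩

lemma s_inv (i : Fin r) : (S.s i)⁻¹ = S.s i := inv_eq_of_mul_eq_one_left (S.s_mul_s i)

/-- The element attached to a word in the simple reflections. -/
def wd (l : List (Fin r)) : E ≃ₗ[ℝ] E := (l.map S.s).prod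

@[simp] lemma wd_nil : S.wd [] = 1 := rfl
@[simp] lemma wd_cons (i : Fin r) (l : List (Fin r)) : S.wd (i :: l) = S.s i * S.wd l := by
  simp [wd]
@[simp] lemma wd_append (l l' : List (Fin r)) : S.wd (l ++ l') = S.wd l * S.wd l' := by
  simp [wd]

lemma wd_mem (l : List (Fin r)) : S.wd l ∈ S.W := by
  induction l with
  | nil => exact S.W.one_mem
  | cons i l ih => rw [wd_cons]; exact S.W.mul_mem (S.s_mem i) ih

lemma exists_wd {g : E ≃ₗ[ℝ] E} (hg : g ∈ S.W) : ∃ l, g = S.wd l := by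
  induction hg using Subgroup.closure_induction with
  | mem x hx => obtain ⟨i, rfl⟩ := hx; exact ⟨[i], by simp⟩
  | one => exact ⟨[], rfl⟩
  | mul x y _ _ hx hy =>
    obtain ⟨l, rfl⟩ := hx; obtain ⟨l', rfl⟩ := hy
    exact ⟨l ++ l', by simp⟩
  | inv x _ hx =>
    obtain ⟨l, rfl⟩ := hx
    refine ⟨l.reverse, ?_⟩
    induction l with
    | nil => simp
    | cons i l ih => rw [wd_cons, mul_inv_rev, ih (S.wd_mem l), S.s_inv]; simp

/-- Nonnegativity of all coordinates. -/
def Pos (x : E) : Prop := ∀ k, 0 ≤ S.copii k x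

lemma pos_or {g : E ≃ₗ[ℝ] E} (hg : g ∈ S.W) (i : Fin r) :
    S.Pos (g (S.alpha i)) ∨ ∀ k, S.copii k (g (S.alpha i)) ≤ 0 := by
  rcases S.roots g hg i with ⟨c, hc, h⟩ | ⟨c, hc, h⟩
  · left; intro k; rw [h]; simpa [S.codual] using hc k
  · right; intro k; rw [h]; simpa [S.codual] using hc k

/-- A positive root made non-positive by `s j` is `α_j`. -/
lemma eq_alpha {g : E ≃ₗ[ℝ] E} (hg : g ∈ S.W) (i j : Fin r) (h1 : S.Pos (g (S.alpha i)))
    (h2 : ¬ S.Pos (S.s j (g (S.alpha i)))) : g (S.alpha i) = S.alpha j := by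
  have h3 : ∀ k, S.copii k (S.s j (g (S.alpha i))) ≤ 0 := by
    rcases S.pos_or (S.W.mul_mem (S.s_mem j) hg) i with h | h
    · exact absurd h h2
    · exact h
  have h4 : ∀ k, k ≠ j → S.copii k (g (S.alpha i)) = 0 := by
    intro k hk
    have := h3 k
    rw [S.copii_s_ne hk.symm] at this
    exact le_antisymm this (h1 k)
  have h5 : g (S.alpha i) = S.copii j (g (S.alpha i)) • S.alpha j := by
    conv_lhs => rw [S.expand (g (S.alpha i))]
    rw [Finset.sum_eq_single j]
    · intro k _ hk; rw [h4 k hk, zero_smul]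
    · simp
  rcases S.reduced (S.alpha j) ⟨1, Subgroup.one_mem _, j, rfl⟩ (S.copii j (g (S.alpha i)))
    ⟨g, hg, i, h5.symm⟩ with h | h
  · rw [h5, h, one_smul]
  · have := h1 j; rw [h] at this; norm_num at this

/-- Two reflections in the finite group `W` with the same root agree. -/
lemma refl_unique {x : E ≃ₗ[ℝ] E} (hx : x ∈ S.W) (i j : Fin r)
    (h : x (S.alpha i) = S.alpha j) : x * S.s i = S.s j * x := by
  set t : E ≃ₗ[ℝ] E := x * S.s i * x⁻¹ * S.s j with ht
  have htm : t ∈ S.W :=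
    S.W.mul_mem (S.W.mul_mem (S.W.mul_mem hx (S.s_mem i)) (S.W.inv_mem hx)) (S.s_mem j)
  have hxa : x⁻¹ (S.alpha j) = S.alpha i := by
    rw [← h]; exact x.symm_apply_apply _
  have hxx : ∀ v, x (x⁻¹ v) = v := fun v => x.apply_symm_apply v
  have htv : ∀ v, t v = v + (S.coalpha j v - S.coalpha i (x⁻¹ v)) • S.alpha j := by
    intro v
    simp only [ht, LinearEquiv.mul_apply]
    rw [S.hs i, S.hs j]
    simp only [map_sub, map_smul, hxa, hxx, h, S.pairing_self, smul_eq_mul]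
    module
  have hpow : ∀ (n : ℕ) v, (t ^ n) v =
      v + ((n : ℝ) * (S.coalpha j v - S.coalpha i (x⁻¹ v))) • S.alpha j := by
    intro n
    induction n with
    | zero => intro v; simp
    | succ n ih =>
      intro v
      rw [pow_succ, LinearEquiv.mul_apply, ih, htv]
      simp only [map_add, map_smul, hxa, S.pairing_self, smul_eq_mul]
      push_cast
      module
  have : Finite S.W := S.fin
  obtain ⟨n, hn, hn1⟩ := (isOfFinOrder_iff_pow_eq_one).1 (isOfFinOrder_of_finite (⟨t, htm⟩ : S.W))
  have hn2 : t ^ n = 1 := by simpa using congrArg Subtype.val hn1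
  have hz : ∀ v, S.coalpha j v - S.coalpha i (x⁻¹ v) = 0 := by
    intro v
    have := hpow n v
    rw [hn2] at this
    simp only [LinearEquiv.coe_one, id_eq, left_eq_add, smul_eq_zero, S.alpha_ne, or_false,
      mul_eq_zero, Nat.cast_eq_zero] at this
    rcases this with h | h
    · omega
    · exact h
  have ht1 : t = 1 := by
    ext v; rw [htv, hz]; simp
  rw [ht] at ht1
  have h1 : x * S.s i * x⁻¹ = (S.s j)⁻¹ := eq_inv_of_mul_eq_one_left ht1
  rw [S.s_inv] at h1
  rw [← h1]; group

lemma exists_split (i : Fin r) (l : List (Fin r)) (h : ¬ S.Pos (S.wd l (S.alpha i))) :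
    ∃ l1 j l2, l = l1 ++ j :: l2 ∧ S.Pos (S.wd l2 (S.alpha i)) ∧
      ¬ S.Pos (S.s j (S.wd l2 (S.alpha i))) := by
  induction l with
  | nil =>
    exfalso; apply h
    intro k
    simp only [wd_nil, LinearEquiv.coe_one, id_eq, S.codual]
    split_ifs <;> norm_num
  | cons a l ih =>
    by_cases hl : S.Pos (S.wd l (S.alpha i))
    · exact ⟨[], a, l, rfl, hl, by simpa using h⟩
    · obtain ⟨l1, j, l2, rfl, h1, h2⟩ := ih hl
      exact ⟨a :: l1, j, l2, rfl, h1, h2⟩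

lemma pos_of_reduced (l : List (Fin r)) (i : Fin r)
    (hmin : ∀ l', S.wd l' = S.wd (l ++ [i]) → l.length + 1 ≤ l'.length) :
    S.Pos (S.wd l (S.alpha i)) := by
  by_contra h
  obtain ⟨l1, j, l2, rfl, h1, h2⟩ := S.exists_split i l h
  have h3 := S.eq_alpha (S.wd_mem l2) i j h1 h2
  have h4 := S.refl_unique (S.wd_mem l2) i j h3
  have := hmin (l1 ++ l2) (by
    simp only [wd_append, wd_cons, wd_nil, mul_one, mul_assoc]
    rw [h4, ← mul_assoc (S.s j), S.s_mul_s, one_mul])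
  simp at this

lemma Wpar_le (i : Fin r) : S.Wpar i ≤ S.W :=
  Subgroup.closure_mono (by rintro _ ⟨k, -, rfl⟩; exact ⟨k, rfl⟩)

lemma s_mem_Wpar {i k : Fin r} (h : k ≠ i) : S.s k ∈ S.Wpar i :=
  Subgroup.subset_closure ⟨k, h, rfl⟩

lemma copii_Wpar {i : Fin r} {g : E ≃ₗ[ℝ] E} (hg : g ∈ S.Wpar i) :
    ∀ x, S.copii i (g x) = S.copii i x := by
  induction hg using Subgroup.closure_induction with
  | mem x hx => obtain ⟨k, hk, rfl⟩ := hx; exact S.copii_s_ne hk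
  | one => intro x; rfl
  | mul x y _ _ hx hy => intro v; rw [LinearEquiv.mul_apply, hx, hy]
  | inv x _ hx =>
    intro v
    rw [← hx (x⁻¹ v)]
    exact congrArg _ (x.apply_symm_apply v)

lemma Wpar_fix {k : Fin r} {q : E} (hq : ∀ i, i ≠ k → S.coalpha i q = 0)
    {g : E ≃ₗ[ℝ] E} (hg : g ∈ S.Wpar k) : g q = q := by
  induction hg using Subgroup.closure_induction with
  | mem x hx => obtain ⟨j, hj, rfl⟩ := hx; simp [S.hs, hq j hj]
  | one => rfl
  | mul x y _ _ hx hy => rw [LinearEquiv.mul_apply, hy, hx]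
  | inv x _ hx =>
    conv_lhs => rw [← hx]
    exact x.symm_apply_apply q

lemma word_main (l : List (Fin r)) : (∀ l', S.wd l' = S.wd l → l.length ≤ l'.length) →
    ∀ i, S.copii i (S.wd l S.lam) ≤ S.copii i S.lam ∧
      (S.copii i (S.wd l S.lam) = S.copii i S.lam → S.wd l ∈ S.Wpar i) := by
  induction l using List.reverseRecOn with
  | nil => intro _ i; exact ⟨le_rfl, fun _ => Subgroup.one_mem _⟩
  | append_singleton l k ih =>
    intro hmin i
    have hl : ∀ l', S.wd l' = S.wd l → l.length ≤ l'.length := by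
      intro l' h
      have := hmin (l' ++ [k]) (by simp [h])
      simpa using this
    have hp := S.pos_of_reduced l k (by intro l' h; simpa using hmin l' h) i
    obtain ⟨h1, h2⟩ := ih hl i
    have hd := S.dom k
    have he : S.copii i (S.wd (l ++ [k]) S.lam) =
        S.copii i (S.wd l S.lam) - S.coalpha k S.lam * S.copii i (S.wd l (S.alpha k)) := by
      simp [S.hs]
    have hm := mul_nonneg hd.le hp
    refine ⟨by rw [he]; linarith, fun h => ?_⟩
    rw [he] at h
    have hm0 : S.coalpha k S.lam * S.copii i (S.wd l (S.alpha k)) = 0 := by linarith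
    have hmem := h2 (by linarith)
    have h0 : S.copii i (S.wd l (S.alpha k)) = 0 := by
      rcases mul_eq_zero.1 hm0 with h | h
      · exact absurd h hd.ne'
      · exact h
    have hk : k ≠ i := by
      rintro rfl
      rw [S.copii_Wpar hmem, S.codual] at h0
      simp at h0
    rw [wd_append]
    exact Subgroup.mul_mem _ hmem (by simpa using S.s_mem_Wpar hk)

lemma lam_main {g : E ≃ₗ[ℝ] E} (hg : g ∈ S.W) (i : Fin r) :
    S.copii i (g S.lam) ≤ S.copii i S.lam ∧
      (S.copii i (g S.lam) = S.copii i S.lam → g ∈ S.Wpar i) := by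
  classical
  have hex : ∃ n, ∃ l, g = S.wd l ∧ l.length = n := by
    obtain ⟨l, hl⟩ := S.exists_wd hg; exact ⟨_, l, hl, rfl⟩
  obtain ⟨l, hl, hn⟩ := Nat.find_spec hex
  have := S.word_main l (by
    intro l' h
    rw [hn]
    exact Nat.find_min' hex ⟨l', by rw [h, hl], rfl⟩) i
  rw [← hl] at this
  exact this

/-! ### Faces -/

lemma WP_le {g : E ≃ₗ[ℝ] E} (hg : g ∈ S.W) (i : Fin r) {p : E} (hp : p ∈ S.WP) :
    S.copii i (g p) ≤ S.copii i S.lam := by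
  have : S.WP ⊆ {x | ((S.copii i).comp g.toLinearMap) x ≤ S.copii i S.lam} := by
    apply convexHull_min
    · rintro _ ⟨h, hh, rfl⟩
      exact (S.lam_main (S.W.mul_mem hg hh) i).1
    · exact convex_halfSpace_le (LinearMap.isLinear _) _
  exact this hp

lemma mem_Qt {g : E ≃ₗ[ℝ] E} {i : Fin r} (hg : g ∈ S.Wpar i) : g S.lam ∈ S.Qt i := by
  refine ⟨subset_convexHull ℝ _ ⟨g, S.Wpar_le i hg, rfl⟩,
    fun k => S.copii k S.lam - S.copii k (g S.lam), fun k => ?_, ?_⟩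
  · have := (S.lam_main (S.Wpar_le i hg) k).1
    linarith
  · have h := S.expand (S.lam - g S.lam)
    rw [← Finset.add_sum_erase _ _ (Finset.mem_univ i)] at h
    simp only [map_sub, S.copii_Wpar hg, sub_self, zero_smul, zero_add] at h
    rw [← h]; abel

lemma Qt_copii {i : Fin r} {p : E} (hp : p ∈ S.Qt i) : S.copii i p = S.copii i S.lam := by
  obtain ⟨-, a, -, rfl⟩ := hp
  simp only [map_sub, map_sum, map_smul, S.codual, sub_eq_self]
  apply Finset.sum_eq_zero
  intro k hk
  simp [Finset.ne_of_mem_erase hk]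

/-- the identity-type index at `g`. -/
def idx (g : S.W) (i : Fin r) : S.Idx := ⟨i, (g : S.Coset i)⟩

lemma out_rel (g : S.W) (i : Fin r) :
    ((((Quotient.out (g : S.Coset i) : S.W)⁻¹ * g : S.W)) : E ≃ₗ[ℝ] E) ∈ S.Wpar i := by
  have h : ((Quotient.out (g : S.Coset i) : S.W) : S.Coset i) = (g : S.Coset i) :=
    QuotientGroup.out_eq' _
  have := QuotientGroup.eq.1 h
  exact this

lemma lam_mem_translate (g : S.W) (i : Fin r) : (g : E ≃ₗ[ℝ] E) S.lam ∈ S.translate (S.idx g i) := by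
  refine ⟨_, S.mem_Qt (S.out_rel g i), ?_⟩
  simp only [idx, Subgroup.coe_mul, Subgroup.coe_inv, LinearEquiv.mul_apply]
  exact LinearEquiv.apply_symm_apply _ _

lemma exists_idx {s : Set S.Idx} (hs : s.Nonempty) (h : (⋂ p ∈ s, S.translate p).Nonempty) :
    ∃ g : S.W, ∀ p ∈ s, p = S.idx g p.1 := by
  obtain ⟨x, hx⟩ := h
  simp only [Set.mem_iInter] at hx
  have hmem : ∀ p ∈ s, ((Quotient.out p.2 : S.W) : E ≃ₗ[ℝ] E)⁻¹ x ∈ S.Qt p.1 := by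
    intro p hp
    obtain ⟨y, hy, rfl⟩ := hx p hp
    have : ((Quotient.out p.2 : S.W) : E ≃ₗ[ℝ] E)⁻¹ (((Quotient.out p.2 : S.W) : E ≃ₗ[ℝ] E) y) = y :=
      LinearEquiv.symm_apply_apply _ _
    rwa [this]
  obtain ⟨p0, hp0⟩ := hs
  have hxW : x ∈ S.WP := by
    obtain ⟨y, hy, rfl⟩ := hx p0 hp0
    have : S.WP ⊆ (fun y => ((Quotient.out p0.2 : S.W) : E ≃ₗ[ℝ] E) y) ⁻¹' S.WP := by
      apply convexHull_min
      · rintro _ ⟨h, hh, rfl⟩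
        exact subset_convexHull ℝ _ ⟨_, S.W.mul_mem (Quotient.out p0.2 : S.W).2 hh, rfl⟩
      · exact (convex_convexHull ℝ _).linear_preimage (((Quotient.out p0.2 : S.W) : E ≃ₗ[ℝ] E) : E →ₗ[ℝ] E)
    exact this hy.1
  have hxW' := hxW
  rw [WP, mem_convexHull_iff_exists_fintype] at hxW'
  obtain ⟨ι, _, w, z, hw, hw1, hz, hzx⟩ := hxW'
  have : ∃ a, w a ≠ 0 := by
    by_contra hcon
    push Not at hcon
    simp [hcon] at hw1
  obtain ⟨a, ha⟩ := this
  obtain ⟨g, hg, hga⟩ := hz a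
  refine ⟨⟨g, hg⟩, fun p hp => ?_⟩
  obtain ⟨i, c⟩ := p
  set u : S.W := (Quotient.out c : S.W) with hu
  have hval := S.Qt_copii (hmem _ hp)
  simp only [← hu] at hval
  have hle : ∀ b, S.copii i ((u : E ≃ₗ[ℝ] E)⁻¹ (z b)) ≤ S.copii i S.lam := by
    intro b
    obtain ⟨h, hh, hhb⟩ := hz b
    rw [← hhb]
    exact (S.lam_main (S.W.mul_mem (S.W.inv_mem u.2) hh) i).1
  have hsum : ∑ b, w b * (S.copii i S.lam - S.copii i ((u : E ≃ₗ[ℝ] E)⁻¹ (z b))) = 0 := by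
    rw [← hzx] at hval
    simp only [map_sum, map_smul, smul_eq_mul] at hval
    simp only [mul_sub, Finset.sum_sub_distrib, ← Finset.sum_mul, hw1, hval]
    ring
  have h0 := (Finset.sum_eq_zero_iff_of_nonneg (fun b _ => mul_nonneg (hw b)
    (sub_nonneg.2 (hle b)))).1 hsum a (Finset.mem_univ a)
  have h1 : S.copii i ((u : E ≃ₗ[ℝ] E)⁻¹ (z a)) = S.copii i S.lam := by
    rcases mul_eq_zero.1 h0 with h | h
    · exact absurd h ha
    · linarith
  rw [← hga] at h1
  have h2 := (S.lam_main (S.W.mul_mem (S.W.inv_mem u.2) hg) i).2 h1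
  have h3 : (u : S.Coset i) = ((⟨g, hg⟩ : S.W) : S.Coset i) := QuotientGroup.eq.2 h2
  have h4 : (u : S.Coset i) = c := QuotientGroup.out_eq' _
  simp only [idx, ← h3, h4]

end CrysSetup

namespace CrysSetup

variable {r : ℕ} {E : Type*} [AddCommGroup E] [Module ℝ E]
variable (S : CrysSetup r E)

/-! ### The Stanley-Reisner ring and restriction to chambers -/

instance finW : Finite S.W := S.fin
instance fintypeW : Fintype S.W := Fintype.ofFinite _
instance finCoset (i : Fin r) : Finite (S.Coset i) := inferInstance
instance fintypeCoset (i : Fin r) : Fintype (S.Coset i) := Fintype.ofFinite _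

lemma idx_inj (g : S.W) : Function.Injective (S.idx g) := by
  intro i j h
  exact congrArg Sigma.fst h

/-- Restriction to the chamber `g`. -/
def pr (g : S.W) : MvPolynomial S.Idx ℚ →ₐ[ℚ] MvPolynomial (Fin r) ℚ := killCompl (S.idx_inj g)

lemma pr_X_idx (g : S.W) (i : Fin r) : S.pr g (X (S.idx g i)) = X i := by
  have := killCompl_rename_app (R := ℚ) (S.idx_inj g) (X i)
  rwa [rename_X] at this

lemma pr_X_ne (g : S.W) (p : S.Idx) (h : p ≠ S.idx g p.1) : S.pr g (X p) = 0 := by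
  rw [pr, killCompl, aeval_X, dif_neg]
  rintro ⟨i, rfl⟩
  exact h rfl

lemma coeff_pr (g : S.W) (f : MvPolynomial S.Idx ℚ) (s : Fin r →₀ ℕ) :
    coeff s (S.pr g f) = coeff (s.mapDomain (S.idx g)) f := by
  classical
  induction f using MvPolynomial.induction_on' with
  | add p q hp hq => rw [map_add, coeff_add, coeff_add, hp, hq]
  | monomial d c =>
    by_cases hd : (↑d.support : Set S.Idx) ⊆ Set.range (S.idx g)
    · obtain ⟨t, rfl⟩ : ∃ t, d = Finsupp.mapDomain (S.idx g) t :=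
        ⟨_, (Finsupp.mapDomain_comapDomain _ (S.idx_inj g) d hd).symm⟩
      rw [pr, killCompl_monomial_mapDomain, coeff_monomial, coeff_monomial]
      simp only [(Finsupp.mapDomain_injective (S.idx_inj g)).eq_iff]
    · rw [pr, killCompl_monomial_eq_zero_of_not_subset _ _ hd, coeff_zero, coeff_monomial, if_neg]
      rintro rfl
      apply hd
      intro p hp
      have := Finsupp.mapDomain_support hp
      obtain ⟨i, -, rfl⟩ := Finset.mem_image.1 this
      exact ⟨i, rfl⟩

lemma pr_Itil (g : S.W) {f : MvPolynomial S.Idx ℚ} (hf : f ∈ S.Itil) : S.pr g f = 0 := by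
  have : S.Itil ≤ RingHom.ker (S.pr g) := by
    refine Ideal.span_le.2 ?_
    rintro _ ⟨l, hl, rfl, hempty⟩
    show S.pr g _ = 0
    by_contra hne
    have : ∀ p ∈ l, p = S.idx g p.1 := by
      intro p hp
      by_contra h
      apply hne
      rw [map_list_prod, List.prod_eq_zero_iff]
      simp only [List.map_map, List.mem_map]
      exact ⟨p, hp, S.pr_X_ne g p h⟩
    have hmem : (g : E ≃ₗ[ℝ] E) S.lam ∈ ⋂ p ∈ l, S.translate p := by
      simp only [Set.mem_iInter]
      intro p hp
      rw [this p hp]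
      exact S.lam_mem_translate g _
    rw [hempty] at hmem
    exact hmem
  exact this hf

lemma mem_Itil_of_pr {f : MvPolynomial S.Idx ℚ} (hf : ∀ g, S.pr g f = 0) : f ∈ S.Itil := by
  classical
  rw [f.as_sum]
  refine Ideal.sum_mem _ fun d hd => ?_
  by_contra hcon
  have hex : ∃ g : S.W, ∀ p ∈ d.support, p = S.idx g p.1 := by
    by_cases hd0 : d.support = ∅
    · exact ⟨1, by simp [hd0]⟩
    have hne : (↑d.support : Set S.Idx).Nonempty := by
      simpa [Finset.nonempty_iff_ne_empty] using hd0
    apply S.exists_idx hne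
    by_contra hem
    rw [Set.not_nonempty_iff_eq_empty] at hem
    apply hcon
    have hm : (d.support.toList.map (X : S.Idx → MvPolynomial S.Idx ℚ)).prod ∈ S.Itil :=
      Ideal.subset_span ⟨d.support.toList, by simpa using hd0, rfl, by simpa using hem⟩
    refine Ideal.mem_of_dvd _ ?_ hm
    rw [Finset.prod_map_toList, monomial_eq]
    refine Dvd.dvd.mul_left ?_ _
    refine Finset.prod_dvd_prod_of_dvd _ _ fun p hp => ?_
    exact dvd_pow_self _ (Finsupp.mem_support_iff.1 hp)
  obtain ⟨g, hg⟩ := hex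
  have hsub : (↑d.support : Set S.Idx) ⊆ Set.range (S.idx g) := fun p hp => ⟨p.1, (hg p hp).symm⟩
  have h := S.coeff_pr g f (d.comapDomain (S.idx g) (S.idx_inj g).injOn)
  rw [Finsupp.mapDomain_comapDomain _ (S.idx_inj g) d hsub, hf g, coeff_zero] at h
  exact (mem_support_iff.1 hd) h.symm

lemma act_X (g : S.W) (p : S.Idx) : S.act g (X p) = X ⟨p.1, g • p.2⟩ := by
  simp [act]

lemma pr_act (g h : S.W) (f : MvPolynomial S.Idx ℚ) :
    S.pr g (S.act h f) = S.pr (h⁻¹ * g) f := by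
  have : (S.pr g).comp (S.act h).toAlgHom = S.pr (h⁻¹ * g) := by
    ext1 p
    show S.pr g (S.act h (X p)) = _
    rw [act_X]
    obtain ⟨i, c⟩ := p
    have key : h • c = (g : S.Coset i) ↔ c = ((h⁻¹ * g : S.W) : S.Coset i) :=
      smul_eq_iff_eq_inv_smul h
    by_cases hc : c = ((h⁻¹ * g : S.W) : S.Coset i)
    · have h2 := key.2 hc
      simp only [h2]
      rw [hc]
      exact (S.pr_X_idx g i).trans (S.pr_X_idx _ i).symm
    · rw [S.pr_X_ne, S.pr_X_ne]
      · intro hh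
        exact hc (by simpa [idx] using hh)
      · intro hh
        exact hc (key.1 (by simpa [idx] using hh))
  exact DFunLike.congr_fun this f

/-- The embedding of invariants. -/
def Ph : MvPolynomial (Fin r) ℚ →ₐ[ℚ] MvPolynomial S.Idx ℚ :=
  aeval fun i => ∑ c : S.Coset i, X ⟨i, c⟩

lemma Ph_X (i : Fin r) : S.Ph (X i) = ∑ c : S.Coset i, X ⟨i, c⟩ := by simp [Ph]

lemma pr_Ph (g : S.W) (f : MvPolynomial (Fin r) ℚ) : S.pr g (S.Ph f) = f := by
  have : (S.pr g).comp S.Ph = AlgHom.id ℚ _ := by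
    ext1 i
    show S.pr g (S.Ph (X i)) = X i
    rw [Ph_X, map_sum, Finset.sum_eq_single (g : S.Coset i)]
    · exact S.pr_X_idx g i
    · intro c _ hc
      apply S.pr_X_ne
      intro hh
      exact hc (by simpa [idx] using hh)
    · simp
  exact DFunLike.congr_fun this f

lemma act_Ph (g : S.W) (f : MvPolynomial (Fin r) ℚ) : S.act g (S.Ph f) = S.Ph f := by
  have : (S.act g).toAlgHom.comp S.Ph = S.Ph := by
    ext1 i
    show S.act g (S.Ph (X i)) = S.Ph (X i)
    rw [Ph_X, map_sum]
    simp only [act_X]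
    exact Fintype.sum_equiv (MulAction.toPerm g) _ _ (fun c => rfl)
  exact DFunLike.congr_fun this f

/-- The averaging argument. -/
lemma sum_act (f : MvPolynomial S.Idx ℚ) :
    ∑ g, S.act g f - S.Ph (∑ g, S.pr g f) ∈ S.Itil := by
  apply S.mem_Itil_of_pr
  intro h
  rw [map_sub, S.pr_Ph, map_sum, sub_eq_zero]
  simp only [pr_act]
  exact Fintype.sum_equiv ((Equiv.inv S.W).trans (Equiv.mulRight h)) _ _ (fun g => rfl)

end CrysSetup

namespace CrysSetup

variable {r : ℕ} {E : Type*} [AddCommGroup E] [Module ℝ E]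
variable (S : CrysSetup r E)

/-! ### Lattice and linear algebra -/

lemma alpha_mem_lattice (i : Fin r) : S.alpha i ∈ S.rootLattice :=
  Submodule.subset_span ⟨1, S.W.one_mem, i, rfl⟩

lemma W_lattice {g : E ≃ₗ[ℝ] E} (hg : g ∈ S.W) {q : E} (hq : q ∈ S.rootLattice) :
    g q ∈ S.rootLattice := by
  induction hq using Submodule.span_induction with
  | mem x hx =>
    obtain ⟨h, hh, i, rfl⟩ := hx
    exact Submodule.subset_span ⟨g * h, S.W.mul_mem hg hh, i, rfl⟩
  | zero => rw [map_zero]; exact Submodule.zero_mem _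
  | add x y _ _ hx hy => rw [map_add]; exact Submodule.add_mem _ hx hy
  | smul a x _ hx => rw [map_zsmul]; exact Submodule.smul_mem _ _ hx

lemma copii_int {g : E ≃ₗ[ℝ] E} (hg : g ∈ S.W) : ∀ (a : Fin r → ℤ) (i : Fin r),
    ∃ n : ℤ, S.copii i (g (∑ j, (a j : ℝ) • S.alpha j)) = n := by
  obtain ⟨l, rfl⟩ := S.exists_wd hg
  clear hg
  induction l with
  | nil => intro a i; exact ⟨a i, by simp [S.codual]⟩
  | cons k l ih =>
    intro a i
    choose b hb using ih a
    choose c hc using S.crys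
    rw [wd_cons, LinearEquiv.mul_apply, S.hs, S.expand (S.wd l _)]
    simp only [hb]
    refine ⟨b i - (∑ j, b j * c j k) * (if k = i then 1 else 0), ?_⟩
    simp only [map_sub, map_sum, map_smul, smul_eq_mul, S.codual, hc]
    push_cast
    simp

/-- The only `W`-invariant vector is zero. -/
lemma eq_zero_of_coalpha {q : E} (hq : ∀ i, S.coalpha i q = 0) : q = 0 := by
  have hfix : ∀ g : S.W, (g : E ≃ₗ[ℝ] E) q = q := by
    intro g
    obtain ⟨l, hl⟩ := S.exists_wd g.2
    rw [hl]
    clear hl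
    induction l with
    | nil => rfl
    | cons k l ih => rw [wd_cons, LinearEquiv.mul_apply, ih, S.hs, hq]; simp
  have hal : ∀ i, ∑ g : S.W, (g : E ≃ₗ[ℝ] E) (S.alpha i) = 0 := by
    intro i
    have h1 : ∑ g : S.W, (g : E ≃ₗ[ℝ] E) (S.alpha i) =
        ∑ g : S.W, (g : E ≃ₗ[ℝ] E) (S.s i (S.alpha i)) :=
      (Fintype.sum_equiv (Equiv.mulRight (⟨S.s i, S.s_mem i⟩ : S.W)) _ _ (fun g => rfl)).symm
    have h2 : S.s i (S.alpha i) = - S.alpha i := by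
      rw [S.hs, S.pairing_self]; module
    simp only [h2, map_neg, Finset.sum_neg_distrib] at h1
    have h3 : (2 : ℝ) • ∑ g : S.W, (g : E ≃ₗ[ℝ] E) (S.alpha i) = 0 := by
      rw [two_smul]; nth_rewrite 1 [h1]; simp
    exact (smul_eq_zero.1 h3).resolve_left (by norm_num)
  have hall : ∑ g : S.W, (g : E ≃ₗ[ℝ] E) q = 0 := by
    rw [S.expand q]
    simp only [map_sum, map_smul]
    rw [Finset.sum_comm]
    simp [← Finset.smul_sum, hal]
  simp only [hfix, Finset.sum_const, Finset.card_univ] at hall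
  rw [← Nat.cast_smul_eq_nsmul ℝ] at hall
  rcases smul_eq_zero.1 hall with h | h
  · exact absurd (Nat.cast_eq_zero.1 h) Fintype.card_ne_zero
  · exact h

section beta

variable {S} {beta : Fin r → Module.Dual ℝ E}

lemma exists_N (hbeta : S.IsPrimitiveCoweightRay beta) : ∃ N : Matrix (Fin r) (Fin r) ℤ, N.det ≠ 0 ∧
    ∀ j i, beta i (S.alpha j) = (N j i : ℝ) := by
  choose N hN using fun j i => (hbeta i).1 (S.alpha j) (S.alpha_mem_lattice j)
  refine ⟨N, fun hdet => ?_, hN⟩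
  have : ((Matrix.of N).map (Int.castRingHom ℝ)).det = 0 := by
    rw [← RingHom.mapMatrix_apply, ← RingHom.map_det]
    have h : (Matrix.of N).det = 0 := hdet
    rw [h, map_zero]
  obtain ⟨v, hv, hv0⟩ := Matrix.exists_vecMul_eq_zero_iff.2 this
  have hq : ∑ j, v j • S.alpha j = 0 := by
    apply S.eq_zero_of_coalpha
    intro i
    obtain ⟨t, ht, hti⟩ := (hbeta i).2.1
    have h1 : beta i (∑ j, v j • S.alpha j) = 0 := by
      simp only [map_sum, map_smul, hN, smul_eq_mul]
      simpa [Matrix.vecMul, dotProduct] using congrFun hv0 i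
    rw [hti, LinearMap.smul_apply, smul_eq_mul] at h1
    exact (mul_eq_zero.1 h1).resolve_left ht.ne'
  apply hv
  exact funext (Fintype.linearIndependent_iff.1 S.indep v hq)

end beta

end CrysSetup

namespace CrysSetup

variable {r : ℕ} {E : Type*} [AddCommGroup E] [Module ℝ E]
variable (S : CrysSetup r E)

/-! ### The map and its properties -/

/-- Elimination of the variables `y`. -/
def kap (N : Matrix (Fin r) (Fin r) ℤ) :
    MvPolynomial (Fin r ⊕ Fin r) ℚ →ₐ[ℚ] MvPolynomial (Fin r) ℚ :=
  aeval (Sum.elim X fun k => (N.det : ℚ)⁻¹ • ∑ j, (N.adjugate k j : ℚ) • X j)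

lemma kap_inl (N : Matrix (Fin r) (Fin r) ℤ) (i : Fin r) : kap N (X (Sum.inl i)) = X i := by
  simp [kap]

lemma kap_inr (N : Matrix (Fin r) (Fin r) ℤ) (k : Fin r) : kap N (X (Sum.inr k)) =
    (N.det : ℚ)⁻¹ • ∑ j, (N.adjugate k j : ℚ) • X j := by
  simp [kap]

lemma adj_mul (N : Matrix (Fin r) (Fin r) ℤ) (k i : Fin r) :
    ∑ j, N.adjugate k j * N j i = if k = i then N.det else 0 := by
  have := congrFun (congrFun (Matrix.adjugate_mul N) k) i
  simpa [Matrix.mul_apply, Matrix.one_apply] using this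

lemma mul_adj (N : Matrix (Fin r) (Fin r) ℤ) (k i : Fin r) :
    ∑ j, N k j * N.adjugate j i = if k = i then N.det else 0 := by
  have := congrFun (congrFun (Matrix.mul_adjugate N) k) i
  simpa [Matrix.mul_apply, Matrix.one_apply] using this

/-- A multiple of the fundamental weight. -/
def fw (N : Matrix (Fin r) (Fin r) ℤ) (k : Fin r) : E :=
  ∑ j, (N.adjugate k j : ℝ) • S.alpha j

lemma fw_mem (N : Matrix (Fin r) (Fin r) ℤ) (k : Fin r) : S.fw N k ∈ S.rootLattice := by
  refine Submodule.sum_mem _ fun j _ => ?_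
  rw [Int.cast_smul_eq_zsmul]
  exact Submodule.smul_mem _ _ (S.alpha_mem_lattice j)

lemma copii_fw (N : Matrix (Fin r) (Fin r) ℤ) (k i : Fin r) :
    S.copii i (S.fw N k) = N.adjugate k i := by
  simp [fw, S.codual]

variable {S} {beta : Fin r → Module.Dual ℝ E}

lemma beta_fw {N : Matrix (Fin r) (Fin r) ℤ} (hN : ∀ j i, beta i (S.alpha j) = (N j i : ℝ))
    (k i : Fin r) : beta i (S.fw N k) = ((if k = i then N.det else 0 : ℤ) : ℝ) := by
  rw [← adj_mul]
  simp [fw, hN]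

lemma coalpha_eq_zero (hbeta : S.IsPrimitiveCoweightRay beta) {i : Fin r} {q : E}
    (h : beta i q = 0) : S.coalpha i q = 0 := by
  obtain ⟨t, ht, hti⟩ := (hbeta i).2.1
  rw [hti, LinearMap.smul_apply, smul_eq_mul] at h
  exact (mul_eq_zero.1 h).resolve_left ht.ne'

lemma beta_eq_zero (hbeta : S.IsPrimitiveCoweightRay beta) {i : Fin r} {q : E}
    (h : S.coalpha i q = 0) : beta i q = 0 := by
  obtain ⟨t, ht, hti⟩ := (hbeta i).2.1
  rw [hti, LinearMap.smul_apply, h, smul_zero]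

/-- Every polynomial is congruent to its elimination. -/
lemma mk_kap {N : Matrix (Fin r) (Fin r) ℤ} (hdet : N.det ≠ 0)
    (hN : ∀ j i, beta i (S.alpha j) = (N j i : ℝ)) (f : MvPolynomial (Fin r ⊕ Fin r) ℚ) :
    Ideal.Quotient.mkₐ ℚ (IQ r + S.JQ beta) (rename Sum.inl (kap N f)) =
      Ideal.Quotient.mkₐ ℚ (IQ r + S.JQ beta) f := by
  have hd : (N.det : ℚ) ≠ 0 := by exact_mod_cast hdet
  have : ((Ideal.Quotient.mkₐ ℚ (IQ r + S.JQ beta)).comp ((rename Sum.inl).comp (kap N))) =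
      Ideal.Quotient.mkₐ ℚ (IQ r + S.JQ beta) := by
    ext1 v
    rcases v with i | k
    · simp [kap_inl]
    · have hmem : ∑ i, (N.adjugate k i : ℚ) • X (Sum.inl i) -
          ∑ i, ((if k = i then N.det else 0 : ℤ) : ℚ) • X (Sum.inr i) ∈ IQ r + S.JQ beta :=
        Ideal.mem_sup_right (Ideal.subset_span ⟨S.fw N k, S.fw_mem N k, _, _, S.copii_fw N k,
          beta_fw hN k, rfl⟩)
      have h0 := Ideal.Quotient.eq_zero_iff_mem.2 hmem
      rw [map_sub, sub_eq_zero] at h0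
      show Ideal.Quotient.mkₐ ℚ _ (rename Sum.inl (kap N (X (Sum.inr k)))) = _
      rw [kap_inr]
      simp only [map_smul, map_sum, rename_X]
      have h1 := h0
      simp only [← Ideal.Quotient.mkₐ_eq_mk ℚ, map_sum, map_smul] at h1
      rw [h1, Finset.sum_eq_single k]
      · rw [if_pos rfl, smul_smul, inv_mul_cancel₀ hd, one_smul]
      · intro b _ hb
        simp [hb.symm]
      · simp
  exact DFunLike.congr_fun this f

/-- The transfer map vanishes on the ideals. -/
lemma transfer_zero (hbeta : S.IsPrimitiveCoweightRay beta) {f : MvPolynomial S.Idx ℚ}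
    (hf : f ∈ S.Itil + S.Jtil) :
    ∑ g : S.W, Ideal.Quotient.mk (IQ r + S.JQ beta) (rename Sum.inl (S.pr g f)) = 0 := by
  classical
  set A := Ideal.Quotient.mk (IQ r + S.JQ beta) with hA
  obtain ⟨f1, h1, f2, h2, rfl⟩ := Submodule.mem_sup.1 hf
  simp only [map_add, S.pr_Itil _ h1, zero_add]
  clear hf h1
  suffices H : ∀ c : MvPolynomial S.Idx ℚ,
      ∑ g : S.W, A (rename Sum.inl (S.pr g (c * f2))) = 0 by
    simpa using H 1
  induction h2 using Submodule.span_induction with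
  | zero => intro c; simp
  | add x y _ _ hx hy =>
    intro c
    simp only [mul_add, map_add, Finset.sum_add_distrib, hx, hy, add_zero]
  | smul a x _ hx =>
    intro c
    simpa only [smul_eq_mul, ← mul_assoc] using hx (c * a)
  | mem x hx =>
    obtain ⟨q, hq, a, ha, rfl⟩ := hx
    intro c
    induction c using MvPolynomial.induction_on' with
    | add c1 c2 h1 h2 => simp only [add_mul, map_add, Finset.sum_add_distrib, h1, h2, add_zero]
    | monomial d e =>
      -- restriction of the linear form
      have hL : ∀ g : S.W, S.pr g (∑ᶠ p : S.Idx, (a p : ℚ) • X p) =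
          ∑ i, (a (S.idx g i) : ℚ) • X i := by
        intro g
        rw [finsum_eq_sum_of_fintype, map_sum, Fintype.sum_sigma]
        refine Finset.sum_congr rfl fun i _ => ?_
        rw [Finset.sum_eq_single (g : S.Coset i)]
        · rw [map_smul]
          exact congrArg _ (S.pr_X_idx g i)
        · intro c _ hc
          rw [map_smul, S.pr_X_ne, smul_zero]
          intro hh
          exact hc (by simpa [idx] using hh)
        · simp
      have haq : ∀ (g : S.W) i, S.copii i ((g : E ≃ₗ[ℝ] E)⁻¹ q) = (a (S.idx g i) : ℝ) := by
        intro g i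
        rw [← ha]
        have h := S.copii_Wpar (S.out_rel g i) ((g : E ≃ₗ[ℝ] E)⁻¹ q)
        rw [← h]
        simp only [Subgroup.coe_mul, Subgroup.coe_inv, LinearEquiv.mul_apply]
        congr 1
        exact congrArg _ (LinearEquiv.apply_symm_apply _ q)
      set G0 : Finset S.W := Finset.univ.filter fun g => ∀ p ∈ d.support, p = S.idx g p.1 with hG0
      set mon : MvPolynomial (Fin r) ℚ := C e * ∏ p ∈ d.support, X p.1 ^ d p with hmon
      have hm : ∀ g : S.W, S.pr g (monomial d e) = if g ∈ G0 then mon else 0 := by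
        intro g
        rw [monomial_eq, map_mul, Finsupp.prod, map_prod]
        have hC : S.pr g (C e) = C e := (S.pr g).commutes e
        rw [hC]
        split_ifs with hg
        · rw [hmon]
          congr 1
          refine Finset.prod_congr rfl fun p hp => ?_
          have := (Finset.mem_filter.1 hg).2 p hp
          rw [map_pow]
          congr 1
          conv_lhs => rw [this]
          exact S.pr_X_idx g _
        · rw [hG0, Finset.mem_filter] at hg
          simp only [Finset.mem_univ, true_and, not_forall] at hg
          obtain ⟨p, hp, hne⟩ := hg
          rw [Finset.prod_eq_zero hp, mul_zero]
          rw [map_pow, S.pr_X_ne g p hne, zero_pow (Finsupp.mem_support_iff.1 hp)]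
      set Q : E := ∑ g ∈ G0, (g : E ≃ₗ[ℝ] E)⁻¹ q with hQ
      have hQm : Q ∈ S.rootLattice :=
        Submodule.sum_mem _ fun g _ => S.W_lattice (S.W.inv_mem g.2) hq
      choose b hb using fun i => (hbeta i).1 Q hQm
      have hQa : ∀ i, S.copii i Q = ((∑ g ∈ G0, a (S.idx g i) : ℤ) : ℝ) := by
        intro i
        rw [hQ, map_sum, Int.cast_sum]
        exact Finset.sum_congr rfl fun g _ => haq g i
      have hJ : ∑ i, ((∑ g ∈ G0, a (S.idx g i) : ℤ) : ℚ) • X (Sum.inl i) -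
          ∑ i, (b i : ℚ) • X (Sum.inr i) ∈ IQ r + S.JQ beta :=
        Ideal.mem_sup_right (Ideal.subset_span ⟨Q, hQm, _, _, hQa, hb, rfl⟩)
      -- vanishing of coefficients off the support
      have hb0 : ∀ k, (∀ p ∈ d.support, p.1 ≠ k) → b k = 0 := by
        intro k hk
        have hsQ : S.s k Q = Q := by
          rw [hQ, map_sum]
          refine Finset.sum_bij' (fun g _ => g * ⟨S.s k, S.s_mem k⟩)
            (fun g _ => g * ⟨S.s k, S.s_mem k⟩) ?_ ?_ ?_ ?_ ?_
          · intro g hg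
            rw [hG0, Finset.mem_filter] at hg ⊢
            refine ⟨Finset.mem_univ _, fun p hp => (hg.2 p hp).trans ?_⟩
            simp only [idx]
            congr 1
            refine QuotientGroup.eq.2 ?_
            rw [inv_mul_cancel_left]
            exact S.s_mem_Wpar (hk p hp).symm
          · intro g hg
            rw [hG0, Finset.mem_filter] at hg ⊢
            refine ⟨Finset.mem_univ _, fun p hp => (hg.2 p hp).trans ?_⟩
            simp only [idx]
            congr 1
            refine QuotientGroup.eq.2 ?_
            rw [inv_mul_cancel_left]
            exact S.s_mem_Wpar (hk p hp).symm
          · intro g _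
            apply Subtype.ext
            simp [mul_assoc, S.s_mul_s]
          · intro g _
            apply Subtype.ext
            simp [mul_assoc, S.s_mul_s]
          · intro g _
            simp only [Subgroup.coe_mul, mul_inv_rev, S.s_inv, LinearEquiv.mul_apply]
        have hc : S.coalpha k Q = 0 := by
          rw [S.hs, sub_eq_self] at hsQ
          exact (smul_eq_zero.1 hsQ).resolve_right (S.alpha_ne k)
        have := hb k
        rw [beta_eq_zero hbeta hc] at this
        exact_mod_cast this.symm
      have hvan : ∀ k, A (rename Sum.inl mon) * A ((b k : ℚ) • X (Sum.inr k)) = 0 := by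
        intro k
        by_cases hk : ∀ p ∈ d.support, p.1 ≠ k
        · rw [hb0 k hk]; simp
        · push Not at hk
          obtain ⟨p, hp, rfl⟩ := hk
          rw [← map_mul, hA, Ideal.Quotient.eq_zero_iff_mem]
          have hI : (X (Sum.inl p.1) * X (Sum.inr p.1) : MvPolynomial (Fin r ⊕ Fin r) ℚ) ∈
              IQ r + S.JQ beta := Ideal.mem_sup_left (Ideal.subset_span ⟨p.1, rfl⟩)
          refine Ideal.mem_of_dvd _ ?_ hI
          apply mul_dvd_mul
          · rw [← rename_X (R := ℚ) Sum.inl p.1]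
            apply map_dvd
            rw [hmon]
            apply Dvd.dvd.mul_left
            exact (dvd_pow_self _ (Finsupp.mem_support_iff.1 hp)).trans
              (Finset.dvd_prod_of_mem (fun p => (X p.1 : MvPolynomial (Fin r) ℚ) ^ d p) hp)
          · rw [smul_eq_C_mul]
            exact dvd_mul_left _ _
      have hterm : ∀ g : S.W, A (rename Sum.inl (S.pr g (monomial d e * ∑ᶠ p : S.Idx, (a p : ℚ) • X p)))
          = if g ∈ G0 then A (rename Sum.inl mon) *
              A (∑ i, (a (S.idx g i) : ℚ) • X (Sum.inl i)) else 0 := by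
        intro g
        rw [map_mul, hm, hL]
        split_ifs
        · rw [map_mul, map_mul]
          simp only [map_sum, map_smul, rename_X]
        · simp
      simp only [hterm]
      rw [← Finset.sum_filter, Finset.filter_mem_eq_inter, Finset.univ_inter, ← Finset.mul_sum,
        ← map_sum]
      have hs : ∑ g ∈ G0, ∑ i, (a (S.idx g i) : ℚ) • (X (Sum.inl i) : MvPolynomial (Fin r ⊕ Fin r) ℚ) =
          ∑ i, ((∑ g ∈ G0, a (S.idx g i) : ℤ) : ℚ) • X (Sum.inl i) := by
        rw [Finset.sum_comm]
        refine Finset.sum_congr rfl fun i _ => ?_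
        rw [← Finset.sum_smul]
        push_cast
        rfl
      have hz := Ideal.Quotient.eq_zero_iff_mem.2 hJ
      rw [← hA, map_sub, sub_eq_zero] at hz
      rw [hs, hz, map_sum, Finset.mul_sum]
      exact Finset.sum_eq_zero fun k _ => hvan k

lemma Ph_mul_mem (hbeta : S.IsPrimitiveCoweightRay beta) {N : Matrix (Fin r) (Fin r) ℤ}
    (hN : ∀ j i, beta i (S.alpha j) = (N j i : ℝ)) (k : Fin r) (c : S.Coset k) :
    X ⟨k, c⟩ * S.Ph (∑ j, (N.adjugate k j : ℚ) • X j) ∈ S.Itil + S.Jtil := by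
  classical
  set w : S.W := Quotient.out c with hw
  have hfix : ∀ g ∈ S.Wpar k, g (S.fw N k) = S.fw N k := fun g hg =>
    S.Wpar_fix (fun i hi => coalpha_eq_zero hbeta (by rw [beta_fw hN, if_neg hi.symm]; simp)) hg
  have hint : ∀ p : S.Idx, ∃ n : ℤ, S.copii p.1 (((Quotient.out p.2 : S.W) : E ≃ₗ[ℝ] E).symm
      ((w : E ≃ₗ[ℝ] E) (S.fw N k))) = n := fun p =>
    S.copii_int (S.W.mul_mem (S.W.inv_mem (Quotient.out p.2 : S.W).2) w.2) _ p.1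
  choose a ha using hint
  have hJ : (∑ᶠ p : S.Idx, (a p : ℚ) • X p) ∈ S.Jtil :=
    Ideal.subset_span ⟨_, S.W_lattice w.2 (S.fw_mem N k), a, ha, rfl⟩
  rw [finsum_eq_sum_of_fintype] at hJ
  have hPh : S.Ph (∑ j, (N.adjugate k j : ℚ) • X j) =
      ∑ p : S.Idx, (N.adjugate k p.1 : ℚ) • X p := by
    rw [Fintype.sum_sigma]
    simp only [map_sum, map_smul, Ph_X, Finset.smul_sum]
  have hdiff : X ⟨k, c⟩ * (∑ p : S.Idx, (N.adjugate k p.1 : ℚ) • X p -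
      ∑ p : S.Idx, (a p : ℚ) • X p) ∈ S.Itil := by
    rw [← Finset.sum_sub_distrib, Finset.mul_sum]
    refine Ideal.sum_mem _ fun p _ => ?_
    rw [← sub_smul, mul_smul_comm]
    by_cases hne : (⋂ x ∈ ({⟨k, c⟩, p} : Set S.Idx), S.translate x).Nonempty
    · obtain ⟨g, hg⟩ := S.exists_idx ⟨_, Set.mem_insert _ _⟩ hne
      have h1 := hg ⟨k, c⟩ (by simp)
      have h2 := hg p (by simp)
      have h1' : c = (g : S.Coset k) := by simpa [idx] using h1
      have hval : a p = N.adjugate k p.1 := by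
        have hu := S.out_rel g k
        rw [← h1', ← hw] at hu
        have hv := S.out_rel g p.1
        obtain ⟨i, c'⟩ := p
        have h2' : c' = (g : S.Coset i) := by simpa [idx] using h2
        have h3 := ha ⟨i, c'⟩
        simp only at hv h3 ⊢
        rw [← h2'] at hv
        have h4 := S.copii_Wpar hv (((w⁻¹ * g : S.W) : E ≃ₗ[ℝ] E)⁻¹ (S.fw N k))
        rw [hfix _ (Subgroup.inv_mem _ hu), S.copii_fw] at h4
        have h5 : (((Quotient.out c' : S.W)⁻¹ * g : S.W) : E ≃ₗ[ℝ] E) (S.fw N k) =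
            ((Quotient.out c' : S.W) : E ≃ₗ[ℝ] E).symm ((w : E ≃ₗ[ℝ] E) (S.fw N k)) := by
          conv_lhs => rw [← hfix _ (Subgroup.inv_mem _ hu)]
          rw [← LinearEquiv.mul_apply, ← Subgroup.coe_inv, ← Subgroup.coe_mul]
          have : (Quotient.out c' : S.W)⁻¹ * g * (w⁻¹ * g)⁻¹ = (Quotient.out c' : S.W)⁻¹ * w := by
            group
          rw [this]
          rfl
        rw [h5, h3] at h4
        exact_mod_cast h4
      rw [hval, sub_self, zero_smul]
      exact Ideal.zero_mem _
    · rw [Set.not_nonempty_iff_eq_empty] at hne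
      have : (X ⟨k, c⟩ * X p : MvPolynomial S.Idx ℚ) ∈ S.Itil :=
        Ideal.subset_span ⟨[⟨k, c⟩, p], by simp, by simp, by simpa using hne⟩
      rw [smul_eq_C_mul]
      exact Ideal.mul_mem_left _ _ this
  rw [hPh]
  have := Ideal.add_mem _ (Ideal.mem_sup_left (T := S.Jtil) hdiff)
    (Ideal.mem_sup_right (S := S.Itil) (Ideal.mul_mem_left _ (X ⟨k, c⟩) hJ))
  rwa [← mul_add, sub_add_cancel] at this

lemma kap_IQ (hbeta : S.IsPrimitiveCoweightRay beta) {N : Matrix (Fin r) (Fin r) ℤ}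
    (hN : ∀ j i, beta i (S.alpha j) = (N j i : ℝ)) {f : MvPolynomial (Fin r ⊕ Fin r) ℚ}
    (hf : f ∈ IQ r) : S.Ph (kap N f) ∈ S.Itil + S.Jtil := by
  have : IQ r ≤ (S.Itil + S.Jtil).comap (S.Ph.comp (kap N)) := by
    refine Ideal.span_le.2 ?_
    rintro _ ⟨k, rfl⟩
    show S.Ph (kap N _) ∈ S.Itil + S.Jtil
    rw [map_mul, map_mul, kap_inl, kap_inr, map_smul, S.Ph_X, mul_smul_comm, Finset.sum_mul,
      smul_eq_C_mul]
    exact Ideal.mul_mem_left _ _ (Ideal.sum_mem _ fun c _ => Ph_mul_mem hbeta hN k c)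
  exact this hf

lemma kap_JQ {N : Matrix (Fin r) (Fin r) ℤ} (hdet : N.det ≠ 0)
    (hN : ∀ j i, beta i (S.alpha j) = (N j i : ℝ)) {f : MvPolynomial (Fin r ⊕ Fin r) ℚ}
    (hf : f ∈ S.JQ beta) : kap N f = 0 := by
  have hd : (N.det : ℚ) ≠ 0 := by exact_mod_cast hdet
  have : S.JQ beta ≤ RingHom.ker (kap N) := by
    refine Ideal.span_le.2 ?_
    rintro _ ⟨q, hq, a, b, ha, hb, rfl⟩
    show kap N _ = 0
    have hba : ∀ i, b i = ∑ j, a j * N j i := by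
      intro i
      have h := hb i
      rw [S.expand q] at h
      simp only [map_sum, map_smul, ha, hN, smul_eq_mul] at h
      exact_mod_cast h.symm
    simp only [map_sub, map_sum, map_smul, kap_inl, kap_inr, sub_eq_zero, Finset.smul_sum,
      smul_smul]
    rw [Finset.sum_comm]
    refine Finset.sum_congr rfl fun i _ => ?_
    rw [← Finset.sum_smul]
    congr 1
    have h1 : ∑ k, b k * N.adjugate k i = a i * N.det := by
      simp only [hba, Finset.sum_mul]
      rw [Finset.sum_comm]
      simp only [mul_assoc, ← Finset.mul_sum, mul_adj]
      simp
    have h2 : ∑ k, (b k : ℚ) * (N.adjugate k i : ℚ) = (a i : ℚ) * N.det := by exact_mod_cast h1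
    have h3 : ∑ k, (b k : ℚ) * ((N.det : ℚ)⁻¹ * (N.adjugate k i : ℚ)) =
        (N.det : ℚ)⁻¹ * ∑ k, (b k : ℚ) * (N.adjugate k i : ℚ) := by
      rw [Finset.mul_sum]
      exact Finset.sum_congr rfl fun k _ => by ring
    rw [h3, h2]
    field_simp
  exact this hf

end CrysSetup

theorem stmt17 {r : ℕ} {E : Type*} [AddCommGroup E] [Module ℝ E]
    (S : CrysSetup r E) (beta : Fin r → Module.Dual ℝ E)
    (hbeta : S.IsPrimitiveCoweightRay beta)
    (ρ : ↥S.W →* ((MvPolynomial S.Idx ℚ ⧸ (S.Itil + S.Jtil)) ≃ₐ[ℚ]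
      (MvPolynomial S.Idx ℚ ⧸ (S.Itil + S.Jtil))))
    (hρ : ∀ (g : ↥S.W) (f : MvPolynomial S.Idx ℚ),
      ρ g (Ideal.Quotient.mk (S.Itil + S.Jtil) f) =
        Ideal.Quotient.mk (S.Itil + S.Jtil) (S.act g f)) :
    ∃ ψ : MvPolynomial (Fin r ⊕ Fin r) ℚ →ₐ[ℚ] (MvPolynomial S.Idx ℚ ⧸ (S.Itil + S.Jtil)),
      RingHom.ker ψ = CrysSetup.IQ r + S.JQ beta ∧
      (ψ.range : Set (MvPolynomial S.Idx ℚ ⧸ (S.Itil + S.Jtil))) =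
        {x | ∀ g : ↥S.W, ρ g x = x} ∧
      ∀ k : ℕ, Submodule.map ψ.toLinearMap
          (MvPolynomial.homogeneousSubmodule (Fin r ⊕ Fin r) ℚ k) ≤
        Submodule.map (Ideal.Quotient.mkₐ ℚ (S.Itil + S.Jtil)).toLinearMap
          (MvPolynomial.homogeneousSubmodule S.Idx ℚ k) := by
  classical
  obtain ⟨N, hdet, hN⟩ := CrysSetup.exists_N hbeta
  have hcard : (Fintype.card S.W : ℚ) ≠ 0 := by
    exact_mod_cast (Fintype.card_ne_zero : Fintype.card S.W ≠ 0)
  refine ⟨(Ideal.Quotient.mkₐ ℚ (S.Itil + S.Jtil)).comp (S.Ph.comp (CrysSetup.kap N)), ?_, ?_, ?_⟩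
  · apply le_antisymm
    · intro f hf
      have h1 : S.Ph (CrysSetup.kap N f) ∈ S.Itil + S.Jtil :=
        Ideal.Quotient.eq_zero_iff_mem.1 hf
      have h2 := CrysSetup.transfer_zero hbeta h1
      simp only [S.pr_Ph] at h2
      have h3 := CrysSetup.mk_kap (S := S) hdet hN f
      simp only [Ideal.Quotient.mkₐ_eq_mk] at h3
      rw [h3, Finset.sum_const, Finset.card_univ, ← Nat.cast_smul_eq_nsmul ℚ] at h2
      exact Ideal.Quotient.eq_zero_iff_mem.1 ((smul_eq_zero.1 h2).resolve_left hcard)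
    · intro f hf
      obtain ⟨f1, h1, f2, h2, rfl⟩ := Submodule.mem_sup.1 hf
      refine Ideal.Quotient.eq_zero_iff_mem.2 ?_
      show S.Ph (CrysSetup.kap N (f1 + f2)) ∈ _
      rw [map_add, CrysSetup.kap_JQ hdet hN h2, add_zero]
      exact CrysSetup.kap_IQ hbeta hN h1
  · ext x
    constructor
    · rintro ⟨f, rfl⟩ g
      show ρ g (Ideal.Quotient.mk _ (S.Ph (CrysSetup.kap N f))) = _
      rw [hρ, S.act_Ph]
      rfl
    · intro hx
      obtain ⟨f, rfl⟩ := Ideal.Quotient.mk_surjective x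
      have h1 : Ideal.Quotient.mk (S.Itil + S.Jtil) (∑ g, S.act g f) =
          Ideal.Quotient.mk (S.Itil + S.Jtil) (S.Ph (∑ g, S.pr g f)) :=
        Ideal.Quotient.eq.2 (Ideal.mem_sup_left (S.sum_act f))
      rw [map_sum] at h1
      have h2 : ∀ g : S.W, Ideal.Quotient.mk (S.Itil + S.Jtil) (S.act g f) =
          Ideal.Quotient.mk (S.Itil + S.Jtil) f := fun g => by rw [← hρ]; exact hx g
      simp only [h2, Finset.sum_const, Finset.card_univ] at h1
      rw [← Nat.cast_smul_eq_nsmul ℚ] at h1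
      refine ⟨(Fintype.card S.W : ℚ)⁻¹ • rename Sum.inl (∑ g, S.pr g f), ?_⟩
      have h3 : ∀ p : MvPolynomial (Fin r) ℚ, CrysSetup.kap N (rename Sum.inl p) = p := by
        intro p
        rw [CrysSetup.kap, aeval_rename]
        simp
      have h4 : ((Ideal.Quotient.mkₐ ℚ (S.Itil + S.Jtil)).comp (S.Ph.comp (CrysSetup.kap N)))
          (rename Sum.inl (∑ g, S.pr g f)) =
          Ideal.Quotient.mk (S.Itil + S.Jtil) (S.Ph (∑ g, S.pr g f)) := by
        show Ideal.Quotient.mk _ (S.Ph (CrysSetup.kap N (rename Sum.inl (∑ g, S.pr g f)))) = _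
        rw [h3]
      show ((Ideal.Quotient.mkₐ ℚ (S.Itil + S.Jtil)).comp (S.Ph.comp (CrysSetup.kap N))) _ = _
      rw [map_smul, h4, ← h1, smul_smul, inv_mul_cancel₀ hcard, one_smul]
  · rintro k _ ⟨f, hf, rfl⟩
    refine ⟨S.Ph (CrysSetup.kap N f), ?_, rfl⟩
    have hf' : f.IsHomogeneous k := hf
    have h1 : (CrysSetup.kap N f).IsHomogeneous k := by
      have := hf'.aeval (Sum.elim X fun k => (N.det : ℚ)⁻¹ • ∑ j, (N.adjugate k j : ℚ) • X j :
        Fin r ⊕ Fin r → MvPolynomial (Fin r) ℚ) (n := 1) (by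
          rintro (i | i)
          · exact isHomogeneous_X _ _
          · exact (homogeneousSubmodule (Fin r) ℚ 1).smul_mem _
              (Submodule.sum_mem _ fun j _ =>
                (homogeneousSubmodule (Fin r) ℚ 1).smul_mem _ (isHomogeneous_X _ _)))
      rwa [one_mul] at this
    have h2 := h1.aeval (fun i => ∑ c : S.Coset i, (X ⟨i, c⟩ : MvPolynomial S.Idx ℚ)) (n := 1)
      (fun i => Submodule.sum_mem (homogeneousSubmodule S.Idx ℚ 1) fun c _ => isHomogeneous_X _ _)
    rw [one_mul] at h2
    exact h2
end
end
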